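/- Let G be a partially Δ-embedded graph, C a Δ-nested cycle collection of G, D an open disk with D ⊆ ann(C), L an ann(C)-avoiding and D-free linkage of G, and Z a disjoint collection of (C,L)-streams of G. Then tw(L ∪ (⋃C ∖ D)) ≥ min{|C|, |Z|}. -/

import Mathlib

open Set

noncomputable section

/-! ### Basic plane topology notions -/

abbrev Pt2 : Type := ℝ × ℝ

/-- A subset of the plane homeomorphic to a closed disk. -/
def IsClosedDisk (A : Set Pt2) : Prop :=
  Nonempty (↥A ≃ₜ ↥(Metric.closedBall (0 : Pt2) 1))

/-- A subset of the plane homeomorphic to an open disk. -/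
def IsOpenDisk (A : Set Pt2) : Prop :=
  Nonempty (↥A ≃ₜ ↥(Metric.ball (0 : Pt2) 1))

/-- `A` is an arc with endpoints `u` and `v`. -/
def IsTopArc (A : Set Pt2) (u v : Pt2) : Prop :=
  ∃ f : ℝ → Pt2, ContinuousOn f (Icc 0 1) ∧ InjOn f (Icc 0 1) ∧
    f '' Icc 0 1 = A ∧ f 0 = u ∧ f 1 = v

/-! ### Graph-theoretic notions: paths, cycles, linkages, dissolution -/

namespace SimpleGraph.Subgraph

variable {V : Type} {G : SimpleGraph V}

/-- The degree of a vertex in a subgraph. -/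
def deg (M : G.Subgraph) (v : V) : ℕ := (M.neighborSet v).ncard

/-- A cycle: a nonempty connected subgraph in which every vertex has degree exactly 2. -/
def IsCycleGraph (C : G.Subgraph) : Prop :=
  C.verts.Nonempty ∧ C.coe.Connected ∧ ∀ v ∈ C.verts, C.deg v = 2

/-- A path: a nonempty connected subgraph with maximum degree 2 that is not a cycle. -/
def IsPathGraph (P : G.Subgraph) : Prop :=
  P.verts.Nonempty ∧ P.coe.Connected ∧ (∀ v ∈ P.verts, P.deg v ≤ 2) ∧
    ∃ v ∈ P.verts, P.deg v ≤ 1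

/-- The endpoints of a path subgraph (vertices of degree at most 1). -/
def ends (P : G.Subgraph) : Set V := {v ∈ P.verts | P.deg v ≤ 1}

/-- `P` is a non-trivial subpath of (a path of) `L`. -/
def IsSubpathOf (P L : G.Subgraph) : Prop :=
  P ≤ L ∧ P.IsPathGraph ∧ P.edgeSet.Nonempty

/-- The graph obtained from `M` by dissolving all vertices not in `T`:
vertices are the elements of `T`, adjacent whenever joined in `M` by a path whose
internal vertices all avoid `T`. -/
def dissolve (M : G.Subgraph) (T : Set V) (hT : T ⊆ M.verts) : SimpleGraph T :=
  SimpleGraph.fromRel fun u v =>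
    ∃ p : M.coe.Walk ⟨u.1, hT u.2⟩ ⟨v.1, hT v.2⟩,
      p.IsPath ∧ ∀ w ∈ p.support, (w : V) ∈ T → (w : V) = (u : V) ∨ (w : V) = (v : V)

/-- A linkage: a subgraph all of whose connected components are non-trivial paths. -/
def IsLinkage (L : G.Subgraph) : Prop :=
  (∀ v ∈ L.verts, 1 ≤ L.deg v ∧ L.deg v ≤ 2) ∧
  ∀ v, ∀ hv : v ∈ L.verts, ∃ w, ∃ hw : w ∈ L.verts,
    L.coe.Reachable ⟨v, hv⟩ ⟨w, hw⟩ ∧ L.deg w ≤ 1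

/-- The pattern of a linkage: the set of endpoint pairs of its paths. -/
def pattern (L : G.Subgraph) : Set (Sym2 V) :=
  {e | ∃ u v, ∃ hu : u ∈ L.verts, ∃ hv : v ∈ L.verts,
    e = s(u, v) ∧ u ≠ v ∧ u ∈ L.ends ∧ v ∈ L.ends ∧
    L.coe.Reachable ⟨u, hu⟩ ⟨v, hv⟩}

/-- The size of a linkage: its number of connected components (paths). -/
def linkSize (L : G.Subgraph) : ℕ := Nat.card L.coe.ConnectedComponent

/-- A vital linkage: it spans all of `V(G)` and no other linkage of `G` is equivalent to it. -/
def IsVital (L : G.Subgraph) : Prop :=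
  L.verts = Set.univ ∧
  ∀ L' : G.Subgraph, L'.IsLinkage → L'.pattern = L.pattern → L' = L

/-- `Q` is a connected component of `M`. -/
def IsComponentOf (Q M : G.Subgraph) : Prop :=
  Q ≤ M ∧ Q.verts.Nonempty ∧ Q.coe.Connected ∧
  (∀ u v, u ∈ Q.verts → M.Adj u v → v ∈ Q.verts) ∧
  (∀ u v, u ∈ Q.verts → v ∈ Q.verts → M.Adj u v → Q.Adj u v)

/-- `Q` is a `(P₁,P₂)`-path: a path with one endpoint in `P₁`, the other in `P₂`,
containing all edges of `P₁ ∪ P₂`. -/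
def IsPathLinking (P₁ P₂ Q : G.Subgraph) : Prop :=
  Q.IsPathGraph ∧ (∃ a ∈ Q.ends, a ∈ P₁.verts) ∧ (∃ b ∈ Q.ends, b ∈ P₂.verts) ∧
    (P₁ ⊔ P₂).edgeSet ⊆ Q.edgeSet

end SimpleGraph.Subgraph

open SimpleGraph

/-- `cae L B`: the number of edges of `L` that are not edges of `B`. -/
def cae {V : Type} {G : SimpleGraph V} (L B : G.Subgraph) : ℕ :=
  (L.edgeSet \ B.edgeSet).ncard

/-! ### Topological minors -/

/-- A tm-pair of `G`: a subgraph `M` together with a set `T` of branch vertices such that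
all other vertices of `M` have degree exactly 2. -/
structure TMPair {V : Type} (G : SimpleGraph V) where
  M : G.Subgraph
  T : Set V
  hT : T ⊆ M.verts
  deg2 : ∀ v ∈ M.verts, v ∉ T → M.deg v = 2

/-- A tm-pair is a topological minor model of `H` when dissolving the non-branch
vertices yields a graph isomorphic to `H`. -/
def TMPair.IsModelOf {V W : Type} {G : SimpleGraph V} (P : TMPair G)
    (H : SimpleGraph W) : Prop :=
  Nonempty ((P.M.dissolve P.T P.hT) ≃g H)

/-- `H` is a topological minor of `G`. -/
def TopMinor {W V : Type} (H : SimpleGraph W) (G : SimpleGraph V) : Prop :=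
  ∃ P : TMPair G, P.IsModelOf H

/-- `Gb` is (isomorphic to) a subdivision of `H`. -/
def IsSubdivision {V W : Type} (Gb : SimpleGraph V) (H : SimpleGraph W) : Prop :=
  ∃ T : Set V, (∀ v : V, v ∉ T → (⊤ : Gb.Subgraph).deg v = 2) ∧
    Nonempty ((Subgraph.dissolve (⊤ : Gb.Subgraph) T (by simp)) ≃g H)

/-! ### Treewidth via `k`-trees, and tree decompositions -/

/-- `k`-trees, defined recursively. -/
inductive IsKTree (k : ℕ) : (V : Type) → SimpleGraph V → Prop
  | base (V : Type) (G : SimpleGraph V)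
      (h : Nonempty (G ≃g completeGraph (Fin (k + 1)))) : IsKTree k V G
  | step (V : Type) (G : SimpleGraph V) (v : V)
      (hcl : Nonempty ((G.induce (insert v (G.neighborSet v))) ≃g
        completeGraph (Fin (k + 1))))
      (hrec : IsKTree k ↥{u : V | u ≠ v} (G.induce {u : V | u ≠ v})) :
      IsKTree k V G

/-- The treewidth of `G`: the least `k` such that `G` is a subgraph of some `k`-tree. -/
def treewidth {V : Type} (G : SimpleGraph V) : ℕ :=
  sInf {k | ∃ (W : Type) (H : SimpleGraph W), IsKTree k W H ∧
    ∃ f : G →g H, Function.Injective f}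

/-- A tree decomposition of `G`. -/
structure TreeDecomp {V : Type} (G : SimpleGraph V) where
  ι : Type
  tree : SimpleGraph ι
  isTree : tree.IsTree
  bag : ι → Set V
  coverV : ∀ v : V, ∃ i, v ∈ bag i
  coverE : ∀ u v : V, G.Adj u v → ∃ i, u ∈ bag i ∧ v ∈ bag i
  coherent : ∀ v : V, (tree.induce {i | v ∈ bag i}).Connected

/-- The tree decomposition has width at most `w`. -/
def TreeDecomp.widthLE {V : Type} {G : SimpleGraph V} (td : TreeDecomp G) (w : ℕ) : Prop :=
  ∀ i, (td.bag i).ncard ≤ w + 1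

/-- The vital-linkage treewidth bound (unique linkage theorem): `f₁` is non-decreasing and
every (finite) graph having a vital linkage `L` has treewidth at most `f₁ |L|`. -/
def VitalFun (f₁ : ℕ → ℕ) : Prop :=
  Monotone f₁ ∧
  ∀ (W : Type) (_ : Fintype W) (G : SimpleGraph W) (L : G.Subgraph),
    L.IsLinkage → L.IsVital → treewidth G ≤ f₁ L.linkSize

/-! ### Plane embeddings and planarity -/

/-- An embedding of a graph in the plane. -/
structure PlaneEmbedding {V : Type} (G : SimpleGraph V) where
  pos : V → Pt2
  inj : Function.Injective pos
  arc : V → V → Set Pt2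
  symm : ∀ u v, arc u v = arc v u
  isArc : ∀ u v, G.Adj u v → IsTopArc (arc u v) (pos u) (pos v)
  meetsVerts : ∀ u v w, G.Adj u v → pos w ∈ arc u v → w = u ∨ w = v
  meetsArcs : ∀ u v x y, G.Adj u v → G.Adj x y → s(u, v) ≠ s(x, y) →
    arc u v ∩ arc x y ⊆ {pos u, pos v} ∩ {pos x, pos y}

/-- A graph is planar when it admits a plane embedding. -/
def IsPlanar {V : Type} (G : SimpleGraph V) : Prop := Nonempty (PlaneEmbedding G)

/-! ### Partially disk-embedded graphs -/

/-- A graph `G` partially embedded in a closed disk `Δ`: a subgraph (the compass)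
is drawn inside `Δ`, the boundary of `Δ` is a cycle of the compass, and
`(V(G) ∩ Δ, V(G) ∖ int Δ)` is a separation of `G`. -/
structure PDE (V : Type) where
  G : SimpleGraph V
  Δ : Set Pt2
  diskΔ : IsClosedDisk Δ
  compass : G.Subgraph
  pos : V → Pt2
  arc : V → V → Set Pt2
  posInj : Set.InjOn pos compass.verts
  arcSymm : ∀ u v, arc u v = arc v u
  arcIsArc : ∀ u v, compass.Adj u v → IsTopArc (arc u v) (pos u) (pos v)
  arcMeetsVerts : ∀ u v w, compass.Adj u v → w ∈ compass.verts →
    pos w ∈ arc u v → w = u ∨ w = v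
  arcMeetsArcs : ∀ u v x y, compass.Adj u v → compass.Adj x y → s(u, v) ≠ s(x, y) →
    arc u v ∩ arc x y ⊆ {pos u, pos v} ∩ {pos x, pos y}
  posInΔ : ∀ v ∈ compass.verts, pos v ∈ Δ
  arcInΔ : ∀ u v, compass.Adj u v → arc u v ⊆ Δ
  separation : ∀ u v, G.Adj u v → u ∈ compass.verts → pos u ∈ interior Δ →
    v ∈ compass.verts ∧ compass.Adj u v
  boundary : ∃ C : G.Subgraph, C ≤ compass ∧ C.IsCycleGraph ∧
    ((pos '' C.verts) ∪ ⋃ (u) (v) (_ : C.Adj u v), arc u v) = frontier Δ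

namespace PDE

variable {V : Type}

/-- The drawing (point set) of a subgraph of a partially disk-embedded graph. -/
def draw (X : PDE V) (H : X.G.Subgraph) : Set Pt2 :=
  (X.pos '' H.verts) ∪ ⋃ (u) (v) (_ : H.Adj u v), X.arc u v

/-- The points of the plane occupied by a set of vertices (of the compass). -/
def drawVerts (X : PDE V) (S : Set V) : Set Pt2 :=
  X.pos '' (S ∩ X.compass.verts)

/-- The part of a subgraph drawn inside a region `A`. -/
def keep (X : PDE V) (M : X.G.Subgraph) (A : Set Pt2) : X.G.Subgraph :=
  M.deleteVerts {v | ¬ (v ∈ X.compass.verts ∧ X.pos v ∈ A)}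

/-- The subgraph obtained from `M` by deleting all vertices drawn in the region `A`. -/
def cut (X : PDE V) (M : X.G.Subgraph) (A : Set Pt2) : X.G.Subgraph :=
  M.deleteVerts {v | v ∈ X.compass.verts ∧ X.pos v ∈ A}

end PDE

/-! ### Nested cycles and railed annuli (1-based indexing) -/

/-- A `Δ`-nested sequence `C 1, …, C r` of cycles of the compass of `X`, with the
corresponding open disks `D 1 ⊇ ⋯ ⊇ D r`. -/
structure NestedCycles {V : Type} (X : PDE V) (r : ℕ) where
  C : ℕ → X.G.Subgraph
  D : ℕ → Set Pt2
  cycLe : ∀ i ∈ Icc 1 r, C i ≤ X.compass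
  cyc : ∀ i ∈ Icc 1 r, (C i).IsCycleGraph
  cycDisj : ∀ i ∈ Icc 1 r, ∀ j ∈ Icc 1 r, i ≠ j → Disjoint (C i).verts (C j).verts
  diskOpen : ∀ i ∈ Icc 1 r, IsOpenDisk (D i)
  diskSub : ∀ i ∈ Icc 1 r, D i ⊆ X.Δ
  diskBd : ∀ i ∈ Icc 1 r, frontier (D i) = X.draw (C i)
  nested : ∀ i j, 1 ≤ i → i ≤ j → j ≤ r → D j ⊆ D i

namespace NestedCycles

variable {V : Type} {X : PDE V} {r : ℕ}

/-- The `(x,y)`-annulus of the nested cycle collection. -/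
def annIn (N : NestedCycles X r) (x y : ℕ) : Set Pt2 :=
  closure (N.D x) \ N.D y

/-- The annulus of the nested cycle collection. -/
def ann (N : NestedCycles X r) : Set Pt2 := N.annIn 1 r

end NestedCycles

/-- The union of the cycles of a nested cycle collection, as a subgraph. -/
def cyclesUnion {V : Type} {X : PDE V} {r : ℕ} (N : NestedCycles X r) : X.G.Subgraph :=
  ⨆ i ∈ Icc 1 r, N.C i

/-- An `(r,q)`-railed annulus. -/
structure RailedAnnulus {V : Type} (X : PDE V) (r q : ℕ) extends NestedCycles X r where
  P : ℕ → X.G.Subgraph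
  railLe : ∀ j ∈ Icc 1 q, P j ≤ X.compass
  railPath : ∀ j ∈ Icc 1 q, (P j).IsPathGraph
  railDisj : ∀ j ∈ Icc 1 q, ∀ j' ∈ Icc 1 q, j ≠ j' → Disjoint (P j).verts (P j').verts
  railInAnn : ∀ j ∈ Icc 1 q, X.draw (P j) ⊆ toNestedCycles.ann
  cross : ∀ i ∈ Icc 1 r, ∀ j ∈ Icc 1 q, (toNestedCycles.C i ⊓ P j).IsPathGraph

/-- A subgraph `M` is `(s,I)`-confined in the railed annulus `A` (`r = 2t+1`, `s = 2t'+1`):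
its drawing meets the middle `s` cycles only within the rails indexed by `I`. -/
def RailedAnnulus.Confined {V : Type} {X : PDE V} {r q : ℕ} (A : RailedAnnulus X r q)
    (s : ℕ) (I : Set ℕ) (M : X.G.Subgraph) : Prop :=
  ∀ t t' : ℕ, r = 2 * t + 1 → s = 2 * t' + 1 →
    X.draw M ∩ A.toNestedCycles.annIn (t - t') (t + t') ⊆
      ⋃ i ∈ I ∩ Icc 1 q, X.draw (A.P i)

/-- `L'` is a `(C,D,L)`-minimal linkage. -/
def MinimalLinkage {V : Type} {X : PDE V} {r : ℕ} (N : NestedCycles X r) (D : Set Pt2)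
    (L L' : X.G.Subgraph) : Prop :=
  L'.IsLinkage ∧ X.drawVerts L'.ends ∩ N.ann = ∅ ∧ L'.pattern = L.pattern ∧
    L' ≤ L ⊔ X.cut (cyclesUnion N) D ∧
    ∀ L'' : X.G.Subgraph, L''.IsLinkage → X.drawVerts L''.ends ∩ N.ann = ∅ →
      L''.pattern = L.pattern → L'' ≤ L ⊔ X.cut (cyclesUnion N) D →
      cae L' (X.cut (cyclesUnion N) D) ≤ cae L'' (X.cut (cyclesUnion N) D)

/-! ### Mountains, valleys, streams, rivers -/

/-- `P` is a `(C,D,L)`-mountain of `G` based on `C i`, with disk `D'`. -/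
structure IsMountain {V : Type} {X : PDE V} {r : ℕ} (N : NestedCycles X r) (D : Set Pt2)
    (L : X.G.Subgraph) (i : ℕ) (P : X.G.Subgraph) (D' : Set Pt2) : Prop where
  based : 1 ≤ i ∧ i ≤ r
  subpath : P.IsSubpathOf L
  inDisk : X.draw P ⊆ closure (N.D i)
  offInner : X.draw P ∩ N.D r = ∅
  twoComp : Nat.card (P ⊓ N.C i).coe.ConnectedComponent = 2
  endsIn : P.ends ⊆ (P ⊓ N.C i).verts
  endsSep : ∀ a b : V, a ∈ P.ends → b ∈ P.ends → a ≠ b →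
    ∀ (ha : a ∈ (P ⊓ N.C i).verts) (hb : b ∈ (P ⊓ N.C i).verts),
      ¬ (P ⊓ N.C i).coe.Reachable ⟨a, ha⟩ ⟨b, hb⟩
  diskDef : ∃ x ∈ N.D i \ X.draw P,
    D' = closure (connectedComponentIn (N.D i \ X.draw P) x) ∧
    Disjoint (connectedComponentIn (N.D i \ X.draw P) x) (N.D r)
  diskAvoidsT : D' ∩ X.drawVerts L.ends = ∅
  diskAvoidsD : D' ∩ D = ∅

/-- `P` is a `(C,D,L)`-valley of `G` based on `C i`, with disk `D'`. -/
structure IsValley {V : Type} {X : PDE V} {r : ℕ} (N : NestedCycles X r) (D : Set Pt2)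
    (L : X.G.Subgraph) (i : ℕ) (P : X.G.Subgraph) (D' : Set Pt2) : Prop where
  based : 1 ≤ i ∧ i ≤ r
  subpath : P.IsSubpathOf L
  inDisk : X.draw P ⊆ X.Δ \ N.D i
  offOuter : X.draw P ∩ (X.Δ \ closure (N.D 1)) = ∅
  twoComp : Nat.card (P ⊓ N.C i).coe.ConnectedComponent = 2
  endsIn : P.ends ⊆ (P ⊓ N.C i).verts
  endsSep : ∀ a b : V, a ∈ P.ends → b ∈ P.ends → a ≠ b →
    ∀ (ha : a ∈ (P ⊓ N.C i).verts) (hb : b ∈ (P ⊓ N.C i).verts),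
      ¬ (P ⊓ N.C i).coe.Reachable ⟨a, ha⟩ ⟨b, hb⟩
  diskDef : ∃ x ∈ (X.Δ \ closure (N.D i)) \ X.draw P,
    D' = closure (connectedComponentIn ((X.Δ \ closure (N.D i)) \ X.draw P) x) ∧
    Disjoint (connectedComponentIn ((X.Δ \ closure (N.D i)) \ X.draw P) x)
      (X.Δ \ closure (N.D 1))
  diskAvoidsT : D' ∩ X.drawVerts L.ends = ∅
  diskAvoidsD : D' ∩ D = ∅

/-- The height of a mountain based on `C i`: the largest `j` such that `C (i+j-1)`
intersects `P`. -/
def mountainHeight {V : Type} {X : PDE V} {r : ℕ} (N : NestedCycles X r) (i : ℕ)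
    (P : X.G.Subgraph) : ℕ :=
  sSup {j | 1 ≤ j ∧ (X.draw (N.C (i + j - 1)) ∩ X.draw P).Nonempty}

/-- The depth of a valley based on `C i`: the largest `j` such that `C (i-j+1)`
intersects `P`. -/
def valleyDepth {V : Type} {X : PDE V} {r : ℕ} (N : NestedCycles X r) (i : ℕ)
    (P : X.G.Subgraph) : ℕ :=
  sSup {j | 1 ≤ j ∧ (X.draw (N.C (i - j + 1)) ∩ X.draw P).Nonempty}

/-- A mountain (with disk `D'`) is tight. -/
def TightMountain {V : Type} {X : PDE V} {r : ℕ} (N : NestedCycles X r) (D : Set Pt2)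
    (L : X.G.Subgraph) (i : ℕ) (P : X.G.Subgraph) (D' : Set Pt2) : Prop :=
  ∀ d, d = mountainHeight N i P → 2 ≤ d →
    ∃ (Ps : ℕ → X.G.Subgraph) (Ds : ℕ → Set Pt2),
      Ps d = P ∧ Ds d = D' ∧
      (∀ j ∈ Icc 2 d, IsMountain N D L i (Ps j) (Ds j) ∧ mountainHeight N i (Ps j) = j) ∧
      (∀ j ∈ Icc 2 (d - 1), X.draw (Ps j) ⊆ Ds (j + 1))

/-- A valley (with disk `D'`) is tight. -/
def TightValley {V : Type} {X : PDE V} {r : ℕ} (N : NestedCycles X r) (D : Set Pt2)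
    (L : X.G.Subgraph) (i : ℕ) (P : X.G.Subgraph) (D' : Set Pt2) : Prop :=
  ∀ d, d = valleyDepth N i P → 2 ≤ d →
    ∃ (Ps : ℕ → X.G.Subgraph) (Ds : ℕ → Set Pt2),
      Ps d = P ∧ Ds d = D' ∧
      (∀ j ∈ Icc 2 d, IsValley N D L i (Ps j) (Ds j) ∧ valleyDepth N i (Ps j) = j) ∧
      (∀ j ∈ Icc 2 (d - 1), X.draw (Ps j) ⊆ Ds (j + 1))

/-- A `(C,L)`-stream between cycles `C x` and `C y`. -/
def IsStreamBetween {V : Type} {X : PDE V} {r : ℕ} (N : NestedCycles X r)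
    (L : X.G.Subgraph) (x y : ℕ) (P : X.G.Subgraph) : Prop :=
  P.IsSubpathOf L ∧ X.draw P ⊆ N.annIn x y ∧
  ∃ a b : V, a ≠ b ∧ P.ends = {a, b} ∧
    (P ⊓ N.C x).verts = {a} ∧ (P ⊓ N.C y).verts = {b}

/-- A disjoint collection of streams between `C x` and `C y`: streams whose union is
a linkage. -/
def IsStreamCollection {V : Type} {X : PDE V} {r : ℕ} (N : NestedCycles X r)
    (L : X.G.Subgraph) (x y : ℕ) (Z : Set (X.G.Subgraph)) : Prop :=
  (∀ P ∈ Z, IsStreamBetween N L x y P) ∧ (sSup Z).IsLinkage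

/-- A `(C,L)`-river: a stream that is a subpath of a connected component of
`L ∩ ann(C)` having one endpoint in `C 1` and the other in `C r`. -/
def IsRiver {V : Type} {X : PDE V} {r : ℕ} (N : NestedCycles X r)
    (L : X.G.Subgraph) (P : X.G.Subgraph) : Prop :=
  IsStreamBetween N L 1 r P ∧
  ∃ Q : X.G.Subgraph, Q.IsComponentOf (X.keep L N.ann) ∧ P ≤ Q ∧
    ∃ a b : V, a ≠ b ∧ a ∈ Q.ends ∧ b ∈ Q.ends ∧
      a ∈ (N.C 1).verts ∧ b ∈ (N.C r).verts

/-! ### Walls -/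

/-- Adjacency for the `2r × r` brick-wall grid (before deleting degree-one vertices). -/
def wallRel (r : ℕ) (p q : ℕ × ℕ) : Prop :=
  (1 ≤ p.1 ∧ p.1 + 1 ≤ 2 * r ∧ 1 ≤ p.2 ∧ p.2 ≤ r ∧ q = (p.1 + 1, p.2)) ∨
  (1 ≤ p.1 ∧ p.1 ≤ 2 * r ∧ 1 ≤ p.2 ∧ p.2 + 1 ≤ r ∧ Even (p.1 + p.2) ∧ q = (p.1, p.2 + 1))

def preWall (r : ℕ) : SimpleGraph (ℕ × ℕ) := SimpleGraph.fromRel (wallRel r)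

def elemWallVerts (r : ℕ) : Set (ℕ × ℕ) := {p | 2 ≤ ((preWall r).neighborSet p).ncard}

/-- The elementary `r`-wall. -/
def elemWall (r : ℕ) : SimpleGraph (elemWallVerts r) := (preWall r).induce (elemWallVerts r)

/-- An `r`-wall in `G`, together with its perimeter and its layers. -/
structure WallIn {V : Type} (G : SimpleGraph V) (r : ℕ) where
  W : G.Subgraph
  isWall : IsSubdivision W.coe (elemWall r)
  perim : G.Subgraph
  perimLe : perim ≤ W
  perimCyc : perim.IsCycleGraph
  layer : ℕ → G.Subgraph
  layerOne : layer 1 = perim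
  layerLe : ∀ i, 1 ≤ i → 2 * i + 1 ≤ r → layer i ≤ W
  layerCyc : ∀ i, 1 ≤ i → 2 * i + 1 ≤ r → (layer i).IsCycleGraph
  layerDisj : ∀ i j, 1 ≤ i → 2 * i + 1 ≤ r → 1 ≤ j → 2 * j + 1 ≤ r → i ≠ j →
    Disjoint (layer i).verts (layer j).verts

/-! ### Boundaried graphs and folios -/

/-- A `t`-boundaried graph on a finite (standard) vertex set. -/
structure FinBGraph (t : ℕ) where
  n : ℕ
  G : SimpleGraph (Fin n)
  B : Set (Fin n)
  ρ : B → Fin t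
  inj : Function.Injective ρ

/-- Isomorphism of `t`-boundaried graphs (respecting boundary labels). -/
def FinBGraph.Iso {t : ℕ} (F F' : FinBGraph t) : Prop :=
  ∃ e : F.G ≃g F'.G, ∃ hB : ∀ v : Fin F.n, v ∈ F.B ↔ e v ∈ F'.B,
    ∀ v (hv : v ∈ F.B), F'.ρ ⟨e v, (hB v).mp hv⟩ = F.ρ ⟨v, hv⟩

/-- The number of pairwise non-isomorphic `t`-boundaried graphs with at most `h` vertices. -/
def numBGraphs (t h : ℕ) : ℕ :=
  Nat.card (Quot fun F F' : {F : FinBGraph t // F.n ≤ h} => F.1.Iso F'.1)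

/-- The treewidth (in the boundaried sense) of a boundaried graph is at most `w`. -/
def FinBGraph.TreewidthLE {t : ℕ} (𝔾 : FinBGraph t) (w : ℕ) : Prop :=
  ∃ td : TreeDecomp 𝔾.G, td.widthLE w ∧ ∃ i, 𝔾.B ⊆ td.bag i

/-- `F` is a member of the `h`-folio of the boundaried graph `𝔾`: it has at most `h`
vertices and is (boundary-respecting) isomorphic to the representation of a btm-pair
of `𝔾`. -/
def IsFolioMember {t : ℕ} (h : ℕ) (𝔾 : FinBGraph t) (F : FinBGraph t) : Prop :=
  F.n ≤ h ∧
  ∃ (M : 𝔾.G.Subgraph) (T : Set (Fin 𝔾.n)) (hT : T ⊆ M.verts),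
    (∀ v ∈ M.verts, v ∉ T → M.deg v = 2) ∧ 𝔾.B ⊆ T ∧
    ∃ e : (M.dissolve T hT) ≃g F.G,
      ∃ hB : ∀ v : ↥T, (v : Fin 𝔾.n) ∈ 𝔾.B ↔ e v ∈ F.B,
        ∀ (v : ↥T) (hv : (v : Fin 𝔾.n) ∈ 𝔾.B),
          F.ρ ⟨e v, (hB v).mp hv⟩ = 𝔾.ρ ⟨(v : Fin 𝔾.n), hv⟩

/-! ### The `F`-TM-Deletion parameters -/

/-- The maximum number of vertices of a graph in the collection `F`. -/
def hOf (F : List ((m : ℕ) × SimpleGraph (Fin m))) : ℕ := (F.map Sigma.fst).foldr max 0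

/-- `p_F(G)`: the least `k` such that some set `S` of at most `k` vertices meets all
topological minor models of members of `F` in `G`. -/
def pF (F : List ((m : ℕ) × SimpleGraph (Fin m))) {V : Type} (G : SimpleGraph V) : ℕ :=
  sInf {k | ∃ S : Set V, S.Finite ∧ S.ncard ≤ k ∧
    ∀ H ∈ F, ¬ TopMinor H.2 (G.induce Sᶜ)}

end

/-! ### Continuous logarithms -/

/-- `f` has a continuous branch of the logarithm on `Y`. -/
def HasLog {α : Type*} [TopologicalSpace α] (f : α → ℂ) (Y : Set α) : Prop :=
  ∃ g : α → ℂ, ContinuousOn g Y ∧ ∀ z ∈ Y, Complex.exp (g z) = f z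

/-- Every nonvanishing continuous function on `A` has a continuous logarithm. -/
def IsLogSet {α : Type*} [TopologicalSpace α] (A : Set α) : Prop :=
  ∀ f : α → ℂ, ContinuousOn f A → (∀ z ∈ A, f z ≠ 0) → HasLog f A

section HasLog

variable {α β : Type*} [TopologicalSpace α] [TopologicalSpace β]

lemma HasLog.mono {f : α → ℂ} {Y Y' : Set α} (h : HasLog f Y) (hY : Y' ⊆ Y) : HasLog f Y' := by
  obtain ⟨g, hg, he⟩ := h
  exact ⟨g, hg.mono hY, fun z hz => he z (hY hz)⟩

lemma HasLog.of_norm_sub_lt {f₀ f₁ : α → ℂ} {Y : Set α} (h : HasLog f₀ Y)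
    (h₀ : ContinuousOn f₀ Y) (h₁ : ContinuousOn f₁ Y)
    (hlt : ∀ z ∈ Y, ‖f₁ z - f₀ z‖ < ‖f₀ z‖) : HasLog f₁ Y := by
  obtain ⟨g, hg, he⟩ := h
  have hne : ∀ z ∈ Y, f₀ z ≠ 0 := fun z hz h0 => by
    have := hlt z hz
    rw [h0, norm_zero] at this
    exact absurd this (not_lt.2 (norm_nonneg _))
  have hslit : ∀ z ∈ Y, f₁ z / f₀ z ∈ Complex.slitPlane := by
    intro z hz
    have h1 : f₁ z / f₀ z = 1 + (f₁ z - f₀ z) / f₀ z := by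
      have := hne z hz
      field_simp
      ring
    rw [h1]
    apply Complex.mem_slitPlane_of_norm_lt_one
    rw [norm_div, div_lt_one (norm_pos_iff.2 (hne z hz))]
    exact hlt z hz
  refine ⟨fun z => g z + Complex.log (f₁ z / f₀ z), ?_, ?_⟩
  · exact hg.add ((h₁.div h₀ hne).clog hslit)
  · intro z hz
    rw [Complex.exp_add, he z hz, Complex.exp_log (Complex.slitPlane_ne_zero (hslit z hz))]
    field_simp [hne z hz]

lemma isLogSet_of_convex_isOpen {E : Type*} [NormedAddCommGroup E] [NormedSpace ℝ E] {U : Set E}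
    (hc : Convex ℝ U) (ho : IsOpen U) : IsLogSet U := by
  intro f hf hne
  rcases U.eq_empty_or_nonempty with rfl | hU
  · exact ⟨fun _ => 0, by simp, by simp⟩
  have : ContractibleSpace U := hc.contractibleSpace hU
  have hsc : IsSimplyConnected U := SimplyConnectedSpace.ofContractible U
  obtain ⟨g, hg, he⟩ := Complex.exists_continuousOn_eqOn_exp_comp hsc ho hf
    (by rintro ⟨z, hz, h0⟩; exact hne z hz h0)
  exact ⟨g, hg, fun z hz => he hz⟩

lemma IsLogSet.of_retract {A : Set α} (h : IsLogSet (univ : Set α)) {r : α → α}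
    (hr : Continuous r) (hrA : ∀ z, r z ∈ A) (hid : ∀ z ∈ A, r z = z) : IsLogSet A := by
  intro f hf hne
  obtain ⟨g, hg, he⟩ := h (fun z => f (r z))
    (hf.comp hr.continuousOn (fun z _ => hrA z)) (fun z _ => hne _ (hrA z))
  exact ⟨g, hg.mono (subset_univ _), fun z hz => by
    have := he z (mem_univ z)
    simpa only [hid z hz] using this⟩

lemma IsLogSet.of_homeomorph {A : Set α} {B : Set β} (φ : A ≃ₜ B) (hB : IsLogSet B) :
    IsLogSet A := by
  classical
  intro f hf hne
  rcases A.eq_empty_or_nonempty with rfl | ⟨a₀, ha₀⟩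
  · exact ⟨fun _ => 0, by simp, by simp⟩
  let ψ : β → ℂ := fun b => if hb : b ∈ B then f (φ.symm ⟨b, hb⟩) else 1
  have hψ : ∀ b : B, ψ b = f (φ.symm b) := fun b => by simp [ψ]
  have hψc : ContinuousOn ψ B := by
    rw [continuousOn_iff_continuous_domRestrict]
    have : B.domRestrict ψ = (A.domRestrict f) ∘ φ.symm := by
      ext b
      exact hψ b
    rw [this]
    exact (continuousOn_iff_continuous_domRestrict.1 hf).comp φ.symm.continuous
  obtain ⟨g, hg, he⟩ := hB ψ hψc (fun b hb => by
    rw [hψ ⟨b, hb⟩]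
    exact hne _ (φ.symm ⟨b, hb⟩).2)
  let γ : α → ℂ := fun a => if ha : a ∈ A then g (φ ⟨a, ha⟩) else 0
  have hγ : ∀ a : A, γ a = g (φ a) := fun a => by simp [γ]
  refine ⟨γ, ?_, fun a ha => ?_⟩
  · rw [continuousOn_iff_continuous_domRestrict]
    have : A.domRestrict γ = (B.domRestrict g) ∘ φ := by
      ext b
      exact hγ b
    rw [this]
    exact (continuousOn_iff_continuous_domRestrict.1 hg).comp φ.continuous
  · rw [hγ ⟨a, ha⟩, he _ (φ ⟨a, ha⟩).2, hψ]
    simp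

lemma IsLogSet.image [T2Space α] {B : Set β} (hB : IsLogSet B) (hcpt : IsCompact B) {φ : β → α}
    (hφ : ContinuousOn φ B) (hinj : InjOn φ B) : IsLogSet (φ '' B) := by
  have : CompactSpace B := isCompact_iff_compactSpace.1 hcpt
  let e : B ≃ (φ '' B) := Equiv.Set.imageOfInjOn φ B hinj
  have he : Continuous e :=
    Continuous.subtype_mk (continuousOn_iff_continuous_domRestrict.1 hφ) _
  exact IsLogSet.of_homeomorph (he.homeoOfEquivCompactToT2).symm hB

lemma IsLogSet.Icc (a b : ℝ) : IsLogSet (Icc a b) := by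
  rcases le_or_gt a b with h | h
  · refine (isLogSet_of_convex_isOpen convex_univ isOpen_univ).of_retract
      (r := fun x => (projIcc a b h x : ℝ)) (by fun_prop) (fun z => (projIcc a b h z).2) ?_
    intro z hz
    rw [projIcc_of_mem h hz]
  · rw [Icc_eq_empty (not_le.2 h)]
    exact fun f _ _ => ⟨fun _ => 0, by simp, by simp⟩

/-- The coordinatewise projection of the plane onto the unit ball. -/
noncomputable def clampBall (z : Pt2) : Pt2 := (max (-1) (min 1 z.1), max (-1) (min 1 z.2))

@[fun_prop]
lemma continuous_clampBall : Continuous clampBall := by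
  unfold clampBall
  fun_prop

lemma clampBall_mem (z : Pt2) : clampBall z ∈ Metric.closedBall (0 : Pt2) 1 := by
  simp [clampBall, Prod.norm_def, abs_le]

lemma clampBall_of_mem {z : Pt2} (hz : z ∈ Metric.closedBall (0 : Pt2) 1) : clampBall z = z := by
  obtain ⟨x, y⟩ := z
  simp only [mem_closedBall_zero_iff, Prod.norm_def, sup_le_iff, Real.norm_eq_abs, abs_le] at hz
  simp [clampBall, hz.1.1, hz.1.2, hz.2.1, hz.2.2]

lemma isLogSet_closedBall : IsLogSet (Metric.closedBall (0 : Pt2) 1) :=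
  (isLogSet_of_convex_isOpen convex_univ isOpen_univ).of_retract continuous_clampBall
    clampBall_mem (fun _ hz => clampBall_of_mem hz)

lemma exists_const_of_exp_eq_one {S : Set α} (hS : IsPreconnected S) {d : α → ℂ}
    (hd : ContinuousOn d S) (he : ∀ z ∈ S, Complex.exp (d z) = 1) :
    ∃ c : ℂ, Complex.exp c = 1 ∧ ∀ z ∈ S, d z = c := by
  have h2 : (2 * Real.pi * Complex.I : ℂ) ≠ 0 := by
    simp [Real.pi_ne_zero]
  have hcl : ∀ z ∈ S, ∀ w ∈ S, d z = d w := by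
    intro z hz w hw
    have := hS.constant_of_mapsTo (T := Set.range (fun n : ℤ => (n : ℝ)))
      (f := fun z => (d z / (2 * Real.pi * Complex.I)).re) ?_ ?_ ?_ hz hw
    · obtain ⟨n, hn⟩ := Complex.exp_eq_one_iff.1 (he z hz)
      obtain ⟨m, hm⟩ := Complex.exp_eq_one_iff.1 (he w hw)
      simp only [hn, hm, mul_div_cancel_right₀ _ h2, Complex.intCast_re] at this
      rw [hn, hm, Int.cast_injective this]
    · exact isDiscrete_iff_discreteTopology.2
        Int.isClosedEmbedding_coe_real.isEmbedding.toHomeomorph.symm.isEmbedding.discreteTopology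
    · exact Complex.continuous_re.comp_continuousOn (hd.div_const _)
    · intro z hz
      obtain ⟨n, hn⟩ := Complex.exp_eq_one_iff.1 (he z hz)
      exact ⟨n, by simp only [hn, mul_div_cancel_right₀ _ h2, Complex.intCast_re]⟩
  rcases S.eq_empty_or_nonempty with rfl | ⟨z₀, hz₀⟩
  · exact ⟨0, by simp, by simp⟩
  · exact ⟨d z₀, he z₀ hz₀, fun z hz => hcl z hz z₀ hz₀⟩

lemma HasLog.union {f : α → ℂ} {Y₁ Y₂ : Set α} (h₁ : HasLog f Y₁) (h₂ : HasLog f Y₂)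
    (hc₁ : IsClosed Y₁) (hc₂ : IsClosed Y₂) (hcon : IsPreconnected (Y₁ ∩ Y₂)) :
    HasLog f (Y₁ ∪ Y₂) := by
  classical
  obtain ⟨g₁, hg₁, he₁⟩ := h₁
  obtain ⟨g₂, hg₂, he₂⟩ := h₂
  obtain ⟨c, hc, hd⟩ := exists_const_of_exp_eq_one hcon (d := fun z => g₁ z - g₂ z)
    ((hg₁.mono inter_subset_left).sub (hg₂.mono inter_subset_right)) (by
      rintro z ⟨hz₁, hz₂⟩
      have h0 : f z ≠ 0 := by
        rw [← he₁ z hz₁]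
        exact Complex.exp_ne_zero _
      rw [Complex.exp_sub, he₁ z hz₁, he₂ z hz₂, div_self h0])
  let g : α → ℂ := fun z => if z ∈ Y₁ then g₁ z else g₂ z + c
  have e₁ : ∀ z ∈ Y₁, g z = g₁ z := fun z hz => by simp [g, hz]
  have e₂ : ∀ z ∈ Y₂, g z = g₂ z + c := fun z hz => by
    by_cases hz₁ : z ∈ Y₁
    · rw [e₁ z hz₁, ← hd z ⟨hz₁, hz⟩]
      ring
    · simp [g, hz₁]
  refine ⟨g, ContinuousOn.union_of_isClosed (hg₁.congr e₁)
    ((hg₂.add continuousOn_const).congr e₂) hc₁ hc₂, ?_⟩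
  rintro z (hz | hz)
  · rw [e₁ z hz, he₁ z hz]
  · rw [e₂ z hz, Complex.exp_add, hc, mul_one, he₂ z hz]

lemma HasLog.union_pieces {ι : Type*} {f : α → ℂ} {E : Set α} {Y : ι → Set α} (S : Finset ι)
    (hE : HasLog f E) (hEc : IsClosed E) (hEp : IsPreconnected E)
    (hY : ∀ i ∈ S, HasLog f (E ∪ Y i)) (hYc : ∀ i ∈ S, IsClosed (Y i))
    (hd : ∀ i ∈ S, ∀ j ∈ S, i ≠ j → Y i ∩ Y j ⊆ E) :
    HasLog f (E ∪ ⋃ i ∈ S, Y i) := by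
  classical
  induction S using Finset.induction_on with
  | empty => simpa using hE
  | insert a S ha ih =>
    have h1 := ih (fun i hi => hY i (Finset.mem_insert_of_mem hi))
      (fun i hi => hYc i (Finset.mem_insert_of_mem hi))
      (fun i hi j hj => hd i (Finset.mem_insert_of_mem hi) j (Finset.mem_insert_of_mem hj))
    have hcl : IsClosed (⋃ i ∈ S, Y i) :=
      S.finite_toSet.isClosed_biUnion (fun i hi => hYc i (Finset.mem_insert_of_mem hi))
    have hinter : (E ∪ Y a) ∩ (E ∪ ⋃ i ∈ S, Y i) = E := by
      rw [← union_inter_distrib_left]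
      apply union_eq_self_of_subset_right
      rintro z ⟨hz, hz'⟩
      simp only [mem_iUnion] at hz'
      obtain ⟨i, hi, hzi⟩ := hz'
      exact hd a (Finset.mem_insert_self _ _) i (Finset.mem_insert_of_mem hi)
        (fun h => ha (h ▸ hi)) ⟨hz, hzi⟩
    have h2 := (hY a (Finset.mem_insert_self _ _)).union h1
      (hEc.union (hYc a (Finset.mem_insert_self _ _))) (hEc.union hcl) (by rwa [hinter])
    refine h2.mono ?_
    intro z
    simp only [mem_union, mem_iUnion, Finset.mem_insert]
    rintro (h | ⟨i, rfl | hi, h⟩)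
    · exact Or.inl (Or.inl h)
    · exact Or.inl (Or.inr h)
    · exact Or.inr (Or.inr ⟨i, hi, h⟩)

lemma HasLog.eventually {F : β → α → ℂ} (hF : Continuous fun x : β × α => F x.1 x.2)
    {K : Set α} (hK : IsCompact K) {p : β} (hp : ∀ z ∈ K, F p z ≠ 0) :
    ∀ᶠ q in nhds p, HasLog (F p) K ↔ HasLog (F q) K := by
  have hFp : ∀ q, Continuous (F q) := fun q => hF.comp (Continuous.prodMk_right q)
  have h : ∀ᶠ q in nhds p, ∀ z ∈ K, ‖F q z - F p z‖ < ‖F p z‖ ∧ ‖F p z - F q z‖ < ‖F q z‖ := by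
    apply hK.eventually_forall_of_forall_eventually
    intro z hz
    have hne : 0 < ‖F p z‖ := norm_pos_iff.2 (hp z hz)
    have hFp' : Continuous fun x : β × α => F p x.2 := (hFp p).comp continuous_snd
    refine Filter.Eventually.and ?_ ?_
    · refine ContinuousAt.eventually_lt (by fun_prop) (by fun_prop) ?_
      simpa using hne
    · refine ContinuousAt.eventually_lt (by fun_prop) (by fun_prop) ?_
      simpa using hne
  filter_upwards [h] with q hq
  exact ⟨fun h => h.of_norm_sub_lt (hFp p).continuousOn (hFp q).continuousOn
      (fun z hz => (hq z hz).1),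
    fun h => h.of_norm_sub_lt (hFp q).continuousOn (hFp p).continuousOn
      (fun z hz => (hq z hz).2)⟩

lemma HasLog.homotopy {F : β → α → ℂ} (hF : Continuous fun x : β × α => F x.1 x.2)
    {K : Set α} (hK : IsCompact K) {S : Set β} (hS : IsPreconnected S)
    (hne : ∀ x ∈ S, ∀ z ∈ K, F x z ≠ 0) {p q : β} (hp : p ∈ S) (hq : q ∈ S)
    (h : HasLog (F p) K) : HasLog (F q) K := by
  refine hS.induction₂ (fun p q => HasLog (F p) K ↔ HasLog (F q) K) ?_ ?_ ?_ hp hq |>.1 h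
  · exact fun x hx => (HasLog.eventually hF hK (hne x hx)).filter_mono nhdsWithin_le_nhds
  · exact fun x y z _ _ _ h1 h2 => h1.trans h2
  · exact fun x y _ _ h => h.symm

end HasLog

/-! ### Separation in the plane -/

/-- The identification of the real plane with the complex numbers. -/
noncomputable def cpx (z : Pt2) : ℂ := Complex.equivRealProdCLM.symm z

@[fun_prop]
lemma continuous_cpx : Continuous cpx := Complex.equivRealProdCLM.symm.continuous

lemma cpx_injective : Function.Injective cpx := Complex.equivRealProdCLM.symm.injective

/-- There is a continuous branch of the argument around `p` on `Y`. -/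
def LogAround (Y : Set Pt2) (p : Pt2) : Prop := HasLog (fun z => cpx z - cpx p) Y

lemma IsLogSet.logAround {Y : Set Pt2} (hY : IsLogSet Y) {p : Pt2} (hp : p ∉ Y) :
    LogAround Y p :=
  hY _ (by fun_prop) (fun z hz h => hp (cpx_injective (sub_eq_zero.1 h) ▸ hz))

lemma LogAround.transport {Y S : Set Pt2} (hY : IsCompact Y) (hS : IsPreconnected S)
    (hd : Disjoint Y S) {p q : Pt2} (hp : p ∈ S) (hq : q ∈ S) (h : LogAround Y p) :
    LogAround Y q :=
  HasLog.homotopy (F := fun p z => cpx z - cpx p) (by fun_prop) hY hS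
    (fun x hx z hz h => hd.le_bot ⟨hz, cpx_injective (sub_eq_zero.1 h) ▸ hx⟩) hp hq h

lemma not_hasLog_circle (p : Pt2) {R : ℝ} (hR : 0 < R) {c : ℝ → Pt2}
    (hc : ∀ t, cpx (c t) = cpx p + R * Complex.exp (t * Complex.I)) (hcc : Continuous c) :
    ¬ LogAround (range c) p := by
  rintro ⟨g, hg, he⟩
  have hco : ∀ t ∈ (univ : Set ℝ), Complex.exp (g (c t) - Real.log R - t * Complex.I) = 1 := by
    intro t _
    have h1 := he _ (mem_range_self t)
    simp only [hc, add_sub_cancel_left] at h1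
    rw [Complex.exp_sub, Complex.exp_sub, h1, ← Complex.ofReal_exp,
      Real.exp_log hR]
    have : (R : ℂ) ≠ 0 := by exact_mod_cast hR.ne'
    have := Complex.exp_ne_zero (t * Complex.I)
    field_simp
  have hgc : Continuous fun t => g (c t) :=
    continuousOn_univ.1 (hg.comp hcc.continuousOn (fun t _ => mem_range_self t))
  have hd : Continuous fun t : ℝ => g (c t) - Real.log R - t * Complex.I :=
    (hgc.sub continuous_const).sub (by fun_prop)
  obtain ⟨k, -, hk⟩ := exists_const_of_exp_eq_one isPreconnected_univ hd.continuousOn hco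
  have h0 := hk 0 (mem_univ _)
  have h1 := hk (2 * Real.pi) (mem_univ _)
  have hc' : c (2 * Real.pi) = c 0 := by
    apply cpx_injective
    rw [hc, hc]
    simp
  rw [hc', ← h0] at h1
  have := Real.pi_ne_zero
  simp at h1

theorem not_logAround_of_frontier_subset {U Y : Set Pt2}
    (hb : Bornology.IsBounded U) (hY : IsClosed Y) (hfr : frontier U ⊆ Y) {p : Pt2} (hp : p ∈ U) :
    ¬ LogAround Y p := by
  classical
  rintro ⟨g, hg, he⟩
  obtain ⟨G, hG⟩ := ContinuousMap.exists_restrict_eq hY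
    ⟨Y.domRestrict g, continuousOn_iff_continuous_domRestrict.1 hg⟩
  have hGg : ∀ z ∈ Y, G z = g z := fun z hz => by
    simpa using congrArg (fun φ : C(Y, ℂ) => φ ⟨z, hz⟩) hG
  let F : Pt2 → ℂ := fun z => if z ∈ U then Complex.exp (G z) else cpx z - cpx p
  have hF : Continuous F := by
    apply Continuous.if
    · intro z hz
      have hzY : z ∈ Y := hfr hz
      rw [hGg z hzY, he z hzY]
    · fun_prop
    · fun_prop
  have hF0 : ∀ z ∈ univ, F z ≠ 0 := by
    intro z _
    by_cases hz : z ∈ U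
    · simp [F, hz]
    · simp only [F, hz, if_false]
      exact sub_ne_zero.2 fun h => hz (cpx_injective h ▸ hp)
  obtain ⟨h, hh, hhe⟩ := isLogSet_of_convex_isOpen convex_univ isOpen_univ F hF.continuousOn hF0
  let c : ℝ → ℝ → Pt2 := fun R t =>
    Complex.equivRealProdCLM (cpx p + R * Complex.exp (t * Complex.I))
  have hc : ∀ R t, cpx (c R t) = cpx p + R * Complex.exp (t * Complex.I) := fun R t => by
    exact Complex.equivRealProdCLM.symm_apply_apply _
  obtain ⟨M, hM⟩ := (((hb.isCompact_closure).image continuous_cpx).isBounded).exists_norm_le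
  have hM0 : ‖cpx p‖ ≤ M := hM _ (mem_image_of_mem _ (subset_closure hp))
  have hR : 0 < 2 * M + 1 := by linarith [norm_nonneg (cpx p)]
  refine not_hasLog_circle p hR (hc _) ?_ ⟨h, hh.mono (subset_univ _), ?_⟩
  · simp only [c]
    fun_prop
  · rintro _ ⟨t, rfl⟩
    rw [hhe _ (mem_univ _)]
    have : c (2 * M + 1) t ∉ U := by
      intro hcU
      have h1 := hM _ (mem_image_of_mem _ (subset_closure hcU))
      rw [hc] at h1
      have h2 : ‖((2 * M + 1 : ℝ) : ℂ) * Complex.exp (t * Complex.I)‖ = 2 * M + 1 := by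
        rw [norm_mul, Complex.norm_exp_ofReal_mul_I, mul_one, Complex.norm_real, Real.norm_eq_abs,
          abs_of_pos hR]
      have h3 := norm_sub_le (cpx p + ((2 * M + 1 : ℝ) : ℂ) * Complex.exp (t * Complex.I)) (cpx p)
      rw [add_sub_cancel_left, h2] at h3
      linarith
    simp [F, this]

/-! ### Invariance of domain for disks -/

lemma isPreconnected_sphere_pt2 : IsPreconnected (Metric.sphere (0 : Pt2) 1) := by
  apply isPreconnected_sphere
  rw [rank_prod', CommSemiring.rank_self, one_add_one_eq_two]
  exact Cardinal.one_lt_two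

/-- An injective continuous image of a closed disk is a neighbourhood of the image of its
centre. -/
theorem image_closedBall_mem_nhds {f : Pt2 → Pt2} (hf : Continuous f)
    (hinj : InjOn f (Metric.closedBall 0 1)) : f '' Metric.closedBall 0 1 ∈ nhds (f 0) := by
  have hS : IsCompact (Metric.sphere (0 : Pt2) 1) := isCompact_sphere _ _
  have hball : ∀ y ∈ Metric.sphere (0 : Pt2) 1, ∀ s : ℝ, |s| ≤ 1 →
      s • y ∈ Metric.closedBall (0 : Pt2) 1 := by
    intro y hy s hs
    rw [mem_closedBall_zero_iff, norm_smul, mem_sphere_zero_iff_norm.1 hy, mul_one]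
    exact hs
  have hne : ∀ s ∈ Icc (1 / 2 : ℝ) 1, ∀ y ∈ Metric.sphere (0 : Pt2) 1,
      cpx (f (s • y)) - cpx (f ((s - 1) • y)) ≠ 0 := by
    intro s hs y hy h
    have h1 := hinj (hball y hy s (by rw [abs_le]; constructor <;> linarith [hs.1, hs.2]))
      (hball y hy (s - 1) (by rw [abs_le]; constructor <;> linarith [hs.1, hs.2]))
      (cpx_injective (sub_eq_zero.1 h))
    have h2 : y = 0 := by
      rw [sub_smul, one_smul, eq_sub_iff_add_eq] at h1
      simpa using h1
    rw [h2] at hy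
    simp at hy
  have hodd : ¬ HasLog (fun y => cpx (f ((1 / 2 : ℝ) • y)) - cpx (f ((1 / 2 - 1 : ℝ) • y)))
      (Metric.sphere (0 : Pt2) 1) := by
    rintro ⟨g, hg, he⟩
    have hneg : ∀ y ∈ Metric.sphere (0 : Pt2) 1, -y ∈ Metric.sphere (0 : Pt2) 1 := by simp
    obtain ⟨c, hc, hgc⟩ := exists_const_of_exp_eq_one isPreconnected_sphere_pt2
      (d := fun y => g (-y) - g y - Real.pi * Complex.I)
      (((hg.comp continuous_neg.continuousOn hneg).sub hg).sub continuousOn_const) (by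
        intro y hy
        have h1 := he y hy
        have h2 := he (-y) (hneg y hy)
        have h3 := Complex.exp_ne_zero (g y)
        have h4 : ((1 / 2 : ℝ) • -y : Pt2) = (1 / 2 - 1 : ℝ) • y := by
          rw [smul_neg, ← neg_smul]; norm_num
        have h5 : ((1 / 2 - 1 : ℝ) • -y : Pt2) = (1 / 2 : ℝ) • y := by
          rw [smul_neg, ← neg_smul]; norm_num
        simp only [h4, h5] at h2
        have h6 : Complex.exp (g (-y)) = - Complex.exp (g y) := by rw [h1, h2]; ring
        rw [Complex.exp_sub, Complex.exp_sub, h6, Complex.exp_pi_mul_I]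
        field_simp)
    have hy : ((1, 0) : Pt2) ∈ Metric.sphere (0 : Pt2) 1 := by simp [Prod.norm_def]
    have h1 := hgc _ hy
    have h2 := hgc _ (hneg _ hy)
    simp only [neg_neg] at h2
    have h3 : c = - (Real.pi * Complex.I) := by linear_combination (-(h1 + h2) / 2)
    rw [h3, Complex.exp_neg, Complex.exp_pi_mul_I] at hc
    norm_num at hc
  have hlog : ¬ HasLog (fun y => cpx (f y) - cpx (f 0)) (Metric.sphere (0 : Pt2) 1) := by
    intro h
    apply hodd
    refine HasLog.homotopy (F := fun (s : ℝ) y => cpx (f (s • y)) - cpx (f ((s - 1) • y)))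
      (by fun_prop) hS isPreconnected_Icc hne (p := 1) (q := 1 / 2) ⟨by norm_num, le_rfl⟩
      ⟨le_rfl, by norm_num⟩ ?_
    simpa using h
  have hev := HasLog.eventually (F := fun q y => cpx (f y) - cpx q) (by fun_prop) hS (p := f 0)
    (by simpa using hne 1 ⟨by norm_num, le_rfl⟩)
  filter_upwards [hev] with q hq
  by_contra hcon
  refine hlog (hq.2 ?_)
  refine (isLogSet_closedBall (fun y => cpx (f y) - cpx q) (by fun_prop) ?_).mono
    Metric.sphere_subset_closedBall
  intro z hz h
  exact hcon ⟨z, hz, cpx_injective (sub_eq_zero.1 h)⟩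

namespace IsOpenDisk

variable {A : Set Pt2}

/-- A parametrization of an open disk. -/
lemma exists_param (hA : IsOpenDisk A) : ∃ f : Pt2 → Pt2, ContinuousOn f (Metric.ball 0 1) ∧
    InjOn f (Metric.ball 0 1) ∧ f '' Metric.ball 0 1 = A := by
  classical
  obtain ⟨φ⟩ := hA
  refine ⟨fun y => if hy : y ∈ Metric.ball (0 : Pt2) 1 then φ.symm ⟨y, hy⟩ else 0, ?_, ?_, ?_⟩
  · rw [continuousOn_iff_continuous_domRestrict]
    have : Continuous fun y : Metric.ball (0 : Pt2) 1 => (φ.symm y : Pt2) := by fun_prop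
    convert this using 1
    ext1 y
    exact dif_pos y.2
  · intro y hy z hz h
    simpa [hy, hz, dif_pos, Subtype.val_inj] using h
  · ext x
    constructor
    · rintro ⟨y, hy, rfl⟩
      simp only [hy, dif_pos]
      exact (φ.symm _).2
    · intro hx
      refine ⟨φ ⟨x, hx⟩, (φ ⟨x, hx⟩).2, ?_⟩
      simp

theorem isOpen (hA : IsOpenDisk A) : IsOpen A := by
  obtain ⟨f, hf, hinj, rfl⟩ := hA.exists_param
  rw [isOpen_iff_mem_nhds]
  rintro _ ⟨y, hy, rfl⟩
  obtain ⟨ε, hε, hεb⟩ := Metric.nhds_basis_closedBall.mem_iff.1 (Metric.isOpen_ball.mem_nhds hy)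
  have hmem : ∀ z, y + ε • clampBall z ∈ Metric.ball (0 : Pt2) 1 := by
    intro z
    apply hεb
    have := clampBall_mem z
    rw [mem_closedBall_zero_iff] at this
    rw [mem_closedBall_iff_norm, add_sub_cancel_left, norm_smul, Real.norm_of_nonneg hε.le]
    nlinarith
  have h := image_closedBall_mem_nhds (f := fun z => f (y + ε • clampBall z))
    (hf.comp_continuous (by fun_prop) hmem) (by
      intro z hz w hw h
      have h1 := hinj (hmem z) (hmem w) h
      rw [clampBall_of_mem hz, clampBall_of_mem hw] at h1
      simpa [hε.ne'] using h1)
  have h0 : clampBall 0 = 0 := clampBall_of_mem (by simp)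
  simp only [h0, smul_zero, add_zero] at h
  refine Filter.mem_of_superset h ?_
  rintro _ ⟨z, -, rfl⟩
  exact mem_image_of_mem _ (hmem z)

lemma isLogSet (hA : IsOpenDisk A) : IsLogSet A := by
  obtain ⟨φ⟩ := hA
  exact IsLogSet.of_homeomorph φ
    (isLogSet_of_convex_isOpen (convex_ball _ _) Metric.isOpen_ball)

lemma nonempty (hA : IsOpenDisk A) : A.Nonempty := by
  obtain ⟨f, -, -, rfl⟩ := hA.exists_param
  exact (Metric.nonempty_ball.2 one_pos).image f

lemma isPreconnected (hA : IsOpenDisk A) : IsPreconnected A := by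
  obtain ⟨f, hf, -, rfl⟩ := hA.exists_param
  exact (convex_ball _ _).isPreconnected.image f hf

lemma exists_compact_preconnected (hA : IsOpenDisk A) {S : Set Pt2} (hS : S.Finite)
    (hSA : S ⊆ A) : ∃ E ⊆ A, S ⊆ E ∧ IsCompact E ∧ IsPreconnected E := by
  obtain ⟨f, hf, hinj, rfl⟩ := hA.exists_param
  have hfin : (Metric.ball 0 1 ∩ f ⁻¹' S).Finite :=
    Set.Finite.of_finite_image (hS.subset (by rintro _ ⟨y, hy, rfl⟩; exact hy.2))
      (hinj.mono inter_subset_left)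
  have hsub : convexHull ℝ (Metric.ball 0 1 ∩ f ⁻¹' S) ⊆ Metric.ball 0 1 :=
    convexHull_min inter_subset_left (convex_ball _ _)
  refine ⟨f '' convexHull ℝ (Metric.ball 0 1 ∩ f ⁻¹' S), image_mono hsub, ?_,
    (hfin.isCompact_convexHull (𝕜 := ℝ)).image_of_continuousOn (hf.mono hsub),
    (convex_convexHull ℝ _).isPreconnected.image f (hf.mono hsub)⟩
  intro x hx
  obtain ⟨y, hy, rfl⟩ := hSA hx
  exact mem_image_of_mem f (subset_convexHull ℝ _ ⟨hy, hx⟩)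

end IsOpenDisk

lemma IsClosedDisk.isCompact {A : Set Pt2} (hA : IsClosedDisk A) : IsCompact A := by
  obtain ⟨φ⟩ := hA
  have : CompactSpace (Metric.closedBall (0 : Pt2) 1) :=
    isCompact_iff_compactSpace.1 (isCompact_closedBall _ _)
  exact isCompact_iff_compactSpace.2 φ.symm.compactSpace

/-! ### Connected vertex sets, brambles and treewidth -/

namespace SimpleGraph

variable {V W : Type*} {G : SimpleGraph V}

/-- A nonempty vertex set that induces a connected subgraph. -/
def ConnSet (G : SimpleGraph V) (s : Set V) : Prop :=
  s.Nonempty ∧ ∀ T : Set V, (s ∩ T).Nonempty → (s \ T).Nonempty →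
    ∃ u ∈ s ∩ T, ∃ v ∈ s \ T, G.Adj u v

/-- Two vertex sets touch if they share a vertex or are joined by an edge. -/
def Touch (G : SimpleGraph V) (s t : Set V) : Prop :=
  ∃ u ∈ s, ∃ v ∈ t, u = v ∨ G.Adj u v

lemma ConnSet.mono {G' : SimpleGraph V} (h : G ≤ G') {s : Set V} (hs : ConnSet G s) :
    ConnSet G' s := by
  refine ⟨hs.1, fun T h1 h2 => ?_⟩
  obtain ⟨u, hu, v, hv, huv⟩ := hs.2 T h1 h2
  exact ⟨u, hu, v, hv, h huv⟩

lemma Touch.mono {G' : SimpleGraph V} (h : G ≤ G') {s t s' t' : Set V} (hs : Touch G s t)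
    (hss : s ⊆ s') (htt : t ⊆ t') : Touch G' s' t' := by
  obtain ⟨u, hu, v, hv, huv⟩ := hs
  exact ⟨u, hss hu, v, htt hv, huv.imp_right (fun h' => h h')⟩

lemma Touch.symm {s t : Set V} (h : Touch G s t) : Touch G t s := by
  obtain ⟨u, hu, v, hv, huv⟩ := h
  exact ⟨v, hv, u, hu, huv.imp Eq.symm (fun h => h.symm)⟩

lemma ConnSet.touch_self {s : Set V} (h : ConnSet G s) : Touch G s s := by
  obtain ⟨u, hu⟩ := h.1
  exact ⟨u, hu, u, hu, Or.inl rfl⟩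

lemma ConnSet.singleton (v : V) : ConnSet G {v} := by
  refine ⟨singleton_nonempty v, ?_⟩
  rintro T ⟨u, rfl, hu⟩ ⟨w, rfl, hw⟩
  exact absurd hu hw

lemma ConnSet.exists_adj {s : Set V} (h : ConnSet G s) {v : V} (hv : v ∈ s)
    (hne : (s \ {v}).Nonempty) : ∃ u ∈ s, G.Adj v u := by
  obtain ⟨u, ⟨-, rfl⟩, w, ⟨hw, -⟩, huw⟩ := h.2 {v} ⟨v, hv, rfl⟩ hne
  exact ⟨w, hw, huw⟩

lemma ConnSet.union {s t : Set V} (hs : ConnSet G s) (ht : ConnSet G t) (hst : Touch G s t) :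
    ConnSet G (s ∪ t) := by
  refine ⟨hs.1.inl, fun T h1 h2 => ?_⟩
  by_cases hs1 : (s ∩ T).Nonempty
  · by_cases hs2 : (s \ T).Nonempty
    · obtain ⟨u, hu, v, hv, huv⟩ := hs.2 T hs1 hs2
      exact ⟨u, ⟨Or.inl hu.1, hu.2⟩, v, ⟨Or.inl hv.1, hv.2⟩, huv⟩
    by_cases ht1 : (t ∩ T).Nonempty
    · by_cases ht2 : (t \ T).Nonempty
      · obtain ⟨u, hu, v, hv, huv⟩ := ht.2 T ht1 ht2
        exact ⟨u, ⟨Or.inr hu.1, hu.2⟩, v, ⟨Or.inr hv.1, hv.2⟩, huv⟩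
      · obtain ⟨x, hx | hx, hxT⟩ := h2
        · exact absurd ⟨x, hx, hxT⟩ hs2
        · exact absurd ⟨x, hx, hxT⟩ ht2
    · obtain ⟨u, hu, v, hv, huv⟩ := hst
      have huT : u ∈ T := by_contra fun h => hs2 ⟨u, hu, h⟩
      have hvT : v ∉ T := fun h => ht1 ⟨v, hv, h⟩
      exact ⟨u, ⟨Or.inl hu, huT⟩, v, ⟨Or.inr hv, hvT⟩,
        huv.resolve_left (fun h => hvT (h ▸ huT))⟩
  · by_cases ht2 : (t \ T).Nonempty
    · by_cases ht1 : (t ∩ T).Nonempty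
      · obtain ⟨u, hu, v, hv, huv⟩ := ht.2 T ht1 ht2
        exact ⟨u, ⟨Or.inr hu.1, hu.2⟩, v, ⟨Or.inr hv.1, hv.2⟩, huv⟩
      · obtain ⟨x, hx | hx, hxT⟩ := h1
        · exact absurd ⟨x, hx, hxT⟩ hs1
        · exact absurd ⟨x, hx, hxT⟩ ht1
    · obtain ⟨u, hu, v, hv, huv⟩ := hst
      have huT : u ∉ T := fun h => hs1 ⟨u, hu, h⟩
      have hvT : v ∈ T := by_contra fun h => ht2 ⟨v, hv, h⟩
      exact ⟨v, ⟨Or.inr hv, hvT⟩, u, ⟨Or.inl hu, huT⟩,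
        (huv.resolve_left (fun h => huT (h ▸ hvT))).symm⟩

/-- Deleting a vertex whose neighbours form a clique keeps a set connected. -/
lemma ConnSet.diff_singleton {s : Set V} (h : ConnSet G s) {v : V}
    (hcl : ∀ u ∈ s, ∀ w ∈ s, G.Adj v u → G.Adj v w → u ≠ w → G.Adj u w)
    (hne : (s \ {v}).Nonempty) : ConnSet G (s \ {v}) := by
  refine ⟨hne, fun T h1 h2 => ?_⟩
  obtain ⟨x, ⟨hxs, hxv⟩, hxT⟩ := h1
  obtain ⟨y, ⟨hys, hyv⟩, hyT⟩ := h2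
  obtain ⟨u, ⟨hus, huT, huv⟩, w, ⟨hws, hwT⟩, huw⟩ :=
    h.2 (T \ {v}) ⟨x, hxs, hxT, hxv⟩ ⟨y, hys, fun h => hyT h.1⟩
  obtain ⟨u', ⟨hus', huT'⟩, w', ⟨hws', hwT'⟩, huw'⟩ :=
    h.2 (T ∪ {v}) ⟨x, hxs, Or.inl hxT⟩ ⟨y, hys, fun h => h.elim hyT hyv⟩
  simp only [mem_union, not_or, mem_singleton_iff, mem_sdiff] at *
  by_cases hwv : w = v
  · by_cases hu'v : u' = v
    · subst hu'v
      subst hwv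
      have : u ≠ w' := fun h => hwT'.1 (h ▸ huT)
      exact ⟨u, ⟨⟨hus, huv⟩, huT⟩, w', ⟨⟨hws', hwT'.2⟩, hwT'.1⟩,
        hcl u hus w' hws' huw.symm huw' this⟩
    · exact ⟨u', ⟨⟨hus', hu'v⟩, huT'.resolve_right hu'v⟩, w', ⟨⟨hws', hwT'.2⟩, hwT'.1⟩, huw'⟩
  · exact ⟨u, ⟨⟨hus, huv⟩, huT⟩, w, ⟨⟨hws, hwv⟩, fun h => hwT ⟨h, hwv⟩⟩, huw⟩

lemma ConnSet.image {H : SimpleGraph W} {f : V → W} {s : Set V}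
    (hf : ∀ u ∈ s, ∀ v ∈ s, G.Adj u v → H.Adj (f u) (f v)) (h : ConnSet G s) :
    ConnSet H (f '' s) := by
  refine ⟨h.1.image f, ?_⟩
  rintro T ⟨_, ⟨x, hx, rfl⟩, hxT⟩ ⟨_, ⟨y, hy, rfl⟩, hyT⟩
  obtain ⟨u, hu, v, hv, huv⟩ := h.2 (f ⁻¹' T) ⟨x, hx, hxT⟩ ⟨y, hy, hyT⟩
  exact ⟨f u, ⟨mem_image_of_mem f hu.1, hu.2⟩, f v, ⟨mem_image_of_mem f hv.1, hv.2⟩,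
    hf u hu.1 v hv.1 huv⟩

lemma ConnSet.comap {f : V → W} {H : SimpleGraph W} {s : Set W} (hs : s ⊆ range f)
    (hf : ∀ u v, H.Adj (f u) (f v) → G.Adj u v) (hinj : Function.Injective f)
    (h : ConnSet H s) : ConnSet G (f ⁻¹' s) := by
  refine ⟨?_, ?_⟩
  · obtain ⟨x, hx⟩ := h.1
    obtain ⟨v, rfl⟩ := hs hx
    exact ⟨v, hx⟩
  · rintro T ⟨x, hx, hxT⟩ ⟨y, hy, hyT⟩
    obtain ⟨u, ⟨hu, u, huT, rfl⟩, v, ⟨hv, hvT⟩, huv⟩ := h.2 (f '' T)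
      ⟨f x, hx, mem_image_of_mem f hxT⟩ ⟨f y, hy, fun h => hyT ((hinj.mem_set_image).1 h)⟩
    obtain ⟨v, rfl⟩ := hs hv
    exact ⟨u, ⟨hu, huT⟩, v, ⟨hv, fun h => hvT (mem_image_of_mem f h)⟩, hf u v huv⟩

lemma Touch.comap {f : V → W} {H : SimpleGraph W} {s t : Set W} (hs : s ⊆ range f)
    (ht : t ⊆ range f) (hf : ∀ u v, H.Adj (f u) (f v) → G.Adj u v)
    (hinj : Function.Injective f) (h : Touch H s t) : Touch G (f ⁻¹' s) (f ⁻¹' t) := by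
  obtain ⟨u, hu, v, hv, huv⟩ := h
  obtain ⟨u, rfl⟩ := hs hu
  obtain ⟨v, rfl⟩ := ht hv
  exact ⟨u, hu, v, hv, huv.imp (fun h => hinj h) (hf u v)⟩

lemma Connected.connSet (h : G.Connected) : ConnSet G univ := by
  obtain ⟨v⟩ := h.nonempty
  refine ⟨⟨v, mem_univ v⟩, ?_⟩
  rintro T ⟨x, -, hx⟩ ⟨y, -, hy⟩
  obtain ⟨p⟩ := h.preconnected x y
  obtain ⟨d, -, hd1, hd2⟩ := p.exists_boundary_dart T hx hy
  exact ⟨d.fst, ⟨mem_univ _, hd1⟩, d.snd, ⟨mem_univ _, hd2⟩, d.adj⟩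

end SimpleGraph

/-- Pairwise touching connected sets in a `k`-tree have a hitting set of size at most `k + 1`. -/
theorem IsKTree.exists_hitting_set {k : ℕ} {V : Type} {G : SimpleGraph V} (h : IsKTree k V G) :
    ∀ ℬ : Set (Set V), (∀ B ∈ ℬ, G.ConnSet B) → (∀ B ∈ ℬ, ∀ B' ∈ ℬ, G.Touch B B') →
      ∃ S : Finset V, S.card ≤ k + 1 ∧ ∀ B ∈ ℬ, ∃ v ∈ S, v ∈ B := by
  classical
  induction h with
  | base V G h =>
    obtain ⟨e⟩ := h
    intro ℬ hc _
    refine ⟨Finset.univ.map e.symm.toEquiv.toEmbedding, by simp, fun B hB => ?_⟩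
    obtain ⟨v, hv⟩ := (hc B hB).1
    exact ⟨v, by simp, hv⟩
  | step V G v hcl _ ih =>
    intro ℬ hc ht
    obtain ⟨e⟩ := hcl
    have hclique : ∀ u w, G.Adj v u → G.Adj v w → u ≠ w → G.Adj u w := by
      intro u w hu hw hne
      have h1 : (SimpleGraph.completeGraph (Fin (k + 1))).Adj (e ⟨u, Or.inr hu⟩) (e ⟨w, Or.inr hw⟩) :=
        fun h => hne (congrArg Subtype.val (e.injective h))
      exact e.map_adj_iff.1 h1
    by_cases hall : ∀ B ∈ ℬ, ∃ u ∈ insert v (G.neighborSet v), u ∈ B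
    · refine ⟨Finset.univ.map (e.symm.toEquiv.toEmbedding.trans (Function.Embedding.subtype _)),
        by simp, fun B hB => ?_⟩
      obtain ⟨u, hu, huB⟩ := hall B hB
      refine ⟨u, ?_, huB⟩
      rw [Finset.mem_map]
      exact ⟨e ⟨u, hu⟩, Finset.mem_univ _, by simp⟩
    · push Not at hall
      obtain ⟨B₀, hB₀, hmiss⟩ := hall
      have hne : ∀ B ∈ ℬ, (B \ {v}).Nonempty := by
        intro B hB
        obtain ⟨u, hu, w, hw, huw⟩ := ht B hB B₀ hB₀
        refine ⟨u, hu, ?_⟩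
        rintro rfl
        rcases huw with rfl | huw
        · exact hmiss u (Or.inl rfl) hw
        · exact hmiss w (Or.inr huw) hw
      have hrange : ∀ B : Set V, B \ {v} ⊆ range (Subtype.val : {u : V | u ≠ v} → V) :=
        fun B u hu => ⟨⟨u, hu.2⟩, rfl⟩
      have ht' : ∀ B ∈ ℬ, ∀ B' ∈ ℬ, G.Touch (B \ {v}) (B' \ {v}) := by
        intro B hB B' hB'
        obtain ⟨u, hu, w, hw, huw⟩ := ht B hB B' hB'
        by_cases huv : u = v
        · subst huv
          obtain ⟨u', hu', hadj⟩ := (hc B hB).exists_adj hu (hne B hB)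
          obtain ⟨w', hw', hadj'⟩ : ∃ w' ∈ B', G.Adj u w' := by
            rcases huw with rfl | huw
            · exact (hc B' hB').exists_adj hw (hne B' hB')
            · exact ⟨w, hw, huw⟩
          refine ⟨u', ⟨hu', hadj.ne'⟩, w', ⟨hw', hadj'.ne'⟩, ?_⟩
          exact or_iff_not_imp_left.2 (hclique u' w' hadj hadj')
        · by_cases hwv : w = v
          · subst hwv
            have hwu := (huw.resolve_left huv).symm
            obtain ⟨w', hw', hadj'⟩ := (hc B' hB').exists_adj hw (hne B' hB')
            refine ⟨u, ⟨hu, huv⟩, w', ⟨hw', hadj'.ne'⟩, ?_⟩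
            exact or_iff_not_imp_left.2 (hclique u w' hwu hadj')
          · exact ⟨u, ⟨hu, huv⟩, w, ⟨hw, hwv⟩, huw⟩
      obtain ⟨S, hS, hhit⟩ := ih ((fun B => Subtype.val ⁻¹' (B \ {v})) '' ℬ) (by
          rintro _ ⟨B, hB, rfl⟩
          exact ((hc B hB).diff_singleton (fun u _ w _ => hclique u w) (hne B hB)).comap
            (hrange B) (fun u w h => h) Subtype.val_injective) (by
          rintro _ ⟨B, hB, rfl⟩ _ ⟨B', hB', rfl⟩
          exact (ht' B hB B' hB').comap (hrange B) (hrange B') (fun u w h => h)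
            Subtype.val_injective)
      refine ⟨S.map (Function.Embedding.subtype _), by simpa using hS, fun B hB => ?_⟩
      obtain ⟨u, huS, hu⟩ := hhit _ (mem_image_of_mem _ hB)
      exact ⟨u, Finset.mem_map_of_mem _ huS, hu.1⟩

theorem le_treewidth_of_bramble {V : Type} [Finite V] {G : SimpleGraph V} {k : ℕ}
    (ℬ : Set (Set V)) (hc : ∀ B ∈ ℬ, G.ConnSet B) (ht : ∀ B ∈ ℬ, ∀ B' ∈ ℬ, G.Touch B B')
    (hS : ∀ S : Finset V, S.card ≤ k → ∃ B ∈ ℬ, ∀ v ∈ S, v ∉ B) : k ≤ treewidth G := by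
  classical
  have := Fintype.ofFinite V
  refine le_csInf ⟨Fintype.card V, Fin (Fintype.card V + 1), SimpleGraph.completeGraph _,
    IsKTree.base _ _ ⟨RelIso.refl _⟩,
    ⟨fun v => (Fintype.equivFin V v).castSucc, ?_⟩, ?_⟩ ?_
  · intro a b hab h
    exact hab.ne (by simpa using h)
  · intro a b h
    simpa using h
  · rintro k' ⟨W, H, hH, f, hf⟩
    by_contra hlt
    obtain ⟨S, hSc, hhit⟩ := hH.exists_hitting_set ((fun B => f '' B) '' ℬ) (by
        rintro _ ⟨B, hB, rfl⟩
        exact (hc B hB).image (fun u _ v _ h => f.map_adj h)) (by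
        rintro _ ⟨B, hB, rfl⟩ _ ⟨B', hB', rfl⟩
        obtain ⟨u, hu, v, hv, huv⟩ := ht B hB B' hB'
        exact ⟨f u, mem_image_of_mem f hu, f v, mem_image_of_mem f hv,
          huv.imp (congrArg f) f.map_adj⟩)
    obtain ⟨B, hB, hmiss⟩ := hS (S.preimage f hf.injOn)
      ((Finset.card_le_card_of_injOn f (fun v hv => Finset.mem_preimage.1 hv) hf.injOn).trans
        (hSc.trans (by omega)))
    obtain ⟨_, hwS, v, hv, rfl⟩ := hhit _ (mem_image_of_mem _ hB)
    exact hmiss v (Finset.mem_preimage.2 hwS) hv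

theorem SimpleGraph.Subgraph.le_treewidth_of_bramble {V : Type} [Finite V] {G : SimpleGraph V}
    (M : G.Subgraph) {k : ℕ} (ℬ : Set (Set V)) (hM : ∀ B ∈ ℬ, B ⊆ M.verts)
    (hc : ∀ B ∈ ℬ, M.spanningCoe.ConnSet B)
    (ht : ∀ B ∈ ℬ, ∀ B' ∈ ℬ, M.spanningCoe.Touch B B')
    (hS : ∀ S : Finset V, S.card ≤ k → ∃ B ∈ ℬ, ∀ v ∈ S, v ∉ B) : k ≤ treewidth M.coe := by
  have hrange : ∀ B ∈ ℬ, B ⊆ range (Subtype.val : M.verts → V) := fun B hB => by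
    simpa using hM B hB
  refine _root_.le_treewidth_of_bramble ((fun B => Subtype.val ⁻¹' B) '' ℬ) ?_ ?_ ?_
  · rintro _ ⟨B, hB, rfl⟩
    exact (hc B hB).comap (hrange B hB) (fun u w h => h) Subtype.val_injective
  · rintro _ ⟨B, hB, rfl⟩ _ ⟨B', hB', rfl⟩
    exact (ht B hB B' hB').comap (hrange B hB) (hrange B' hB') (fun u w h => h)
      Subtype.val_injective
  · intro S hSc
    obtain ⟨B, hB, hmiss⟩ := hS (S.map (Function.Embedding.subtype _)) (by simpa using hSc)
    exact ⟨_, mem_image_of_mem _ hB, fun v hv => hmiss v (Finset.mem_map_of_mem _ hv)⟩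

/-! ### Connected subgraphs, paths and cycles -/

namespace SimpleGraph.Subgraph

variable {V : Type} {G : SimpleGraph V}

lemma connSet_verts {H : G.Subgraph} (h : H.coe.Connected) : H.spanningCoe.ConnSet H.verts := by
  have := h.connSet.image (f := Subtype.val) (H := H.spanningCoe) (fun u _ v _ huv => huv)
  simpa using this

lemma spanningCoe_mono {H H' : G.Subgraph} (h : H ≤ H') : H.spanningCoe ≤ H'.spanningCoe :=
  fun _ _ huv => h.2 huv

lemma deg_mono [Finite V] {H H' : G.Subgraph} (h : H ≤ H') (v : V) : H.deg v ≤ H'.deg v :=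
  ncard_le_ncard (fun _ hu => h.2 hu) (toFinite _)

lemma eq_of_adj_of_deg_le_one [Finite V] {H : G.Subgraph} {v u w : V} (hv : H.deg v ≤ 1)
    (hu : H.Adj v u) (hw : H.Adj v w) : u = w :=
  (ncard_le_one (toFinite _)).1 hv u hu w hw

lemma IsCycleGraph.connSet {C : G.Subgraph} (hC : C.IsCycleGraph) :
    C.spanningCoe.ConnSet C.verts := connSet_verts hC.2.1

lemma IsCycleGraph.isCycles {C : G.Subgraph} (hC : C.IsCycleGraph) : C.spanningCoe.IsCycles := by
  rintro v ⟨w, hw⟩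
  exact hC.2.2 v (C.edge_vert hw)

lemma IsCycleGraph.exists_adj {C : G.Subgraph} (hC : C.IsCycleGraph) {v : V} (hv : v ∈ C.verts) :
    ∃ u, C.Adj v u := by
  have h := hC.2.2 v hv
  by_contra! hne
  have : C.neighborSet v = ∅ := eq_empty_of_forall_notMem hne
  rw [deg, this, ncard_empty] at h
  omega

section Cycle

variable [Finite V] {C : G.Subgraph} (hC : C.IsCycleGraph) {u v : V} (huv : C.Adj u v)
include hC huv

lemma IsCycleGraph.connSet_deleteEdges :
    (C.deleteEdges {s(u, v)}).spanningCoe.ConnSet C.verts := by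
  have hr : (C.deleteEdges {s(u, v)}).spanningCoe.Reachable u v := by
    have := hC.isCycles.reachable_deleteEdges (v := u) (w := v) huv
    refine this.mono ?_
    intro a b hab
    simpa using hab
  refine ⟨hC.1, fun T h1 h2 => ?_⟩
  have key : ∀ T : Set V, u ∈ T → v ∉ T → ∃ a ∈ C.verts ∩ T, ∃ b ∈ C.verts \ T,
      (C.deleteEdges {s(u, v)}).spanningCoe.Adj a b := by
    intro T hu hv
    obtain ⟨p⟩ := hr
    obtain ⟨d, -, hd1, hd2⟩ := p.exists_boundary_dart T hu hv
    have hd := ((deleteEdges_adj ..).1 d.adj).1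
    exact ⟨d.fst, ⟨C.edge_vert hd, hd1⟩, d.snd, ⟨C.edge_vert hd.symm, hd2⟩, d.adj⟩
  obtain ⟨a, ha, b, hb, hab⟩ := hC.connSet.2 T h1 h2
  by_cases he : s(a, b) = s(u, v)
  · rcases Sym2.eq_iff.1 he with ⟨rfl, rfl⟩ | ⟨rfl, rfl⟩
    · exact key T ha.2 hb.2
    · obtain ⟨x, hx, y, hy, hxy⟩ := key Tᶜ hb.2 (fun h => h ha.2)
      exact ⟨y, ⟨hy.1, by simpa using hy.2⟩, x, hx, hxy.symm⟩
  · exact ⟨a, ha, b, hb, (deleteEdges_adj ..).2 ⟨hab, by simpa using he⟩⟩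

omit huv in
lemma IsCycleGraph.deg_deleteEdges_le (w : V) (hw : w ∈ C.verts) :
    (C.deleteEdges {s(u, v)}).deg w ≤ 2 :=
  (deg_mono (deleteEdges_le _) w).trans (hC.2.2 w hw).le

lemma IsCycleGraph.deg_deleteEdges_left : (C.deleteEdges {s(u, v)}).deg u ≤ 1 := by
  have h : (C.deleteEdges {s(u, v)}).neighborSet u ⊆ C.neighborSet u \ {v} := by
    intro w hw
    have := (deleteEdges_adj ..).1 hw
    exact ⟨this.1, fun h => this.2 (by rw [h]; rfl)⟩
  have h2 := ncard_sdiff_singleton_of_mem (s := C.neighborSet u) (a := v) huv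
  have h3 := hC.2.2 u (C.edge_vert huv)
  have h4 := ncard_le_ncard h (toFinite _)
  unfold deg at *
  omega

lemma IsCycleGraph.deg_deleteEdges_right : (C.deleteEdges {s(u, v)}).deg v ≤ 1 := by
  rw [Sym2.eq_swap]
  exact hC.deg_deleteEdges_left huv.symm

omit [Finite V] in
lemma IsCycleGraph.exists_ne : ((C.verts \ {u}) \ {v}).Nonempty := by
  obtain ⟨w, hw, hne⟩ := exists_ne_of_one_lt_ncard
    (show 1 < (C.neighborSet u).ncard from by
      have := hC.2.2 u (C.edge_vert huv)
      unfold deg at this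
      omega) v
  exact ⟨w, ⟨C.edge_vert hw.symm, hw.ne.symm⟩, hne⟩

/-- Deleting two adjacent vertices of a cycle leaves a connected set. -/
lemma IsCycleGraph.connSet_diff_edge :
    C.spanningCoe.ConnSet ((C.verts \ {u}) \ {v}) := by
  have hne := hC.exists_ne huv
  have h1 := (hC.connSet_deleteEdges huv).diff_singleton (v := u)
    (fun a _ b _ ha hb hab => absurd (eq_of_adj_of_deg_le_one (hC.deg_deleteEdges_left huv) ha hb)
      hab) (hne.mono sdiff_subset)
  exact (h1.diff_singleton (v := v)
    (fun a _ b _ ha hb hab => absurd (eq_of_adj_of_deg_le_one (hC.deg_deleteEdges_right huv) ha hb)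
      hab) hne).mono (spanningCoe_mono (deleteEdges_le _))

lemma IsCycleGraph.touch_diff_edge : C.spanningCoe.Touch {u} ((C.verts \ {u}) \ {v}) := by
  have hne := hC.exists_ne huv
  obtain ⟨w, hw, hadj⟩ := (hC.connSet_deleteEdges huv).exists_adj (C.edge_vert huv)
    (hne.mono sdiff_subset)
  have h := (deleteEdges_adj ..).1 hadj
  exact ⟨u, rfl, w, ⟨⟨hw, h.1.ne.symm⟩, fun hwv => h.2 (by rw [hwv]; rfl)⟩, Or.inr h.1⟩

/-- A subgraph containing a cycle has treewidth at least two. -/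
theorem IsCycleGraph.two_le_treewidth {M : G.Subgraph} (hM : C ≤ M) : 2 ≤ treewidth M.coe := by
  have hle := spanningCoe_mono hM
  have hu := C.edge_vert huv
  have hv := C.edge_vert huv.symm
  have t1 : M.spanningCoe.Touch {u} {v} := ⟨u, rfl, v, rfl, Or.inr (hM.2 huv)⟩
  have t2 : M.spanningCoe.Touch {u} ((C.verts \ {u}) \ {v}) :=
    (hC.touch_diff_edge huv).mono hle subset_rfl subset_rfl
  have t3 : M.spanningCoe.Touch {v} ((C.verts \ {u}) \ {v}) := by
    have := (hC.touch_diff_edge huv.symm).mono hle subset_rfl subset_rfl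
    rwa [sdiff_right_comm] at this
  have c3 := (hC.connSet_diff_edge huv).mono hle
  refine M.le_treewidth_of_bramble {{u}, {v}, (C.verts \ {u}) \ {v}} ?_ ?_ ?_ ?_
  · rintro B (rfl | rfl | rfl)
    · exact singleton_subset_iff.2 (hM.1 hu)
    · exact singleton_subset_iff.2 (hM.1 hv)
    · exact (sdiff_subset.trans sdiff_subset).trans hM.1
  · rintro B (rfl | rfl | rfl)
    · exact ConnSet.singleton u
    · exact ConnSet.singleton v
    · exact c3
  · rintro B (rfl | rfl | rfl) B' (rfl | rfl | rfl)
    exacts [(ConnSet.singleton u).touch_self, t1, t2, t1.symm, (ConnSet.singleton v).touch_self,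
      t3, t2.symm, t3.symm, c3.touch_self]
  · intro S hS
    by_contra! h
    obtain ⟨x, hx, rfl⟩ := h _ (Or.inl rfl)
    obtain ⟨y, hy, rfl⟩ := h _ (Or.inr (Or.inl rfl))
    obtain ⟨z, hz, ⟨-, hzx⟩, hzy⟩ := h _ (Or.inr (Or.inr rfl))
    have : 2 < S.card := Finset.two_lt_card.2 ⟨x, hx, y, hy, z, hz, huv.ne,
      fun h => hzx h.symm, fun h => hzy h.symm⟩
    omega

end Cycle

end SimpleGraph.Subgraph

lemma SimpleGraph.connSet_supp {V : Type*} {K : SimpleGraph V} (c : K.ConnectedComponent) :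
    K.ConnSet c.supp := by
  refine ⟨c.nonempty_supp, ?_⟩
  rintro T ⟨x, hx, hxT⟩ ⟨y, hy, hyT⟩
  classical
  obtain ⟨p⟩ := ConnectedComponent.exact (hx.trans hy.symm)
  obtain ⟨d, hd, hd1, hd2⟩ := p.exists_boundary_dart T hxT hyT
  have h1 : d.fst ∈ c.supp := by
    rw [ConnectedComponent.mem_supp_iff, ← hx]
    exact (ConnectedComponent.sound (p.takeUntil _ (p.dart_fst_mem_support_of_mem_darts hd)).reachable).symm
  exact ⟨d.fst, ⟨h1, hd1⟩, d.snd, ⟨(c.mem_supp_congr_adj d.adj).1 h1, hd2⟩, d.adj⟩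

/-! ### Drawings -/

namespace PDE

open SimpleGraph

variable {V : Type} {X : PDE V}

lemma pos_mem_draw {H : X.G.Subgraph} {v : V} (hv : v ∈ H.verts) : X.pos v ∈ X.draw H :=
  Or.inl (mem_image_of_mem _ hv)

lemma arc_subset_draw {H : X.G.Subgraph} {u v : V} (h : H.Adj u v) : X.arc u v ⊆ X.draw H :=
  fun _ hx => Or.inr (mem_iUnion₂.2 ⟨u, v, mem_iUnion.2 ⟨h, hx⟩⟩)

lemma mem_draw {H : X.G.Subgraph} {x : Pt2} : x ∈ X.draw H ↔
    (∃ v ∈ H.verts, X.pos v = x) ∨ ∃ u v, H.Adj u v ∧ x ∈ X.arc u v := by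
  simp [draw]

lemma draw_mono {H H' : X.G.Subgraph} (h : H ≤ H') : X.draw H ⊆ X.draw H' := by
  intro x hx
  rcases mem_draw.1 hx with ⟨v, hv, rfl⟩ | ⟨u, v, huv, hx⟩
  · exact pos_mem_draw (h.1 hv)
  · exact arc_subset_draw (h.2 huv) hx

lemma isCompact_arc {u v : V} (h : X.compass.Adj u v) : IsCompact (X.arc u v) := by
  obtain ⟨f, hf, -, he, -⟩ := X.arcIsArc u v h
  rw [← he]
  exact isCompact_Icc.image_of_continuousOn hf

lemma isPreconnected_arc {u v : V} (h : X.compass.Adj u v) : IsPreconnected (X.arc u v) := by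
  obtain ⟨f, hf, -, he, -⟩ := X.arcIsArc u v h
  rw [← he]
  exact isPreconnected_Icc.image f hf

lemma isLogSet_arc {u v : V} (h : X.compass.Adj u v) : IsLogSet (X.arc u v) := by
  obtain ⟨f, hf, hinj, he, -⟩ := X.arcIsArc u v h
  rw [← he]
  exact (IsLogSet.Icc 0 1).image isCompact_Icc hf hinj

lemma pos_left_mem_arc {u v : V} (h : X.compass.Adj u v) : X.pos u ∈ X.arc u v := by
  obtain ⟨f, -, -, he, h0, -⟩ := X.arcIsArc u v h
  rw [← he, ← h0]
  exact mem_image_of_mem f ⟨le_rfl, zero_le_one⟩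

lemma pos_right_mem_arc {u v : V} (h : X.compass.Adj u v) : X.pos v ∈ X.arc u v := by
  rw [X.arcSymm]
  exact pos_left_mem_arc h.symm

lemma isCompact_draw [Finite V] {H : X.G.Subgraph} (h : H ≤ X.compass) :
    IsCompact (X.draw H) := by
  refine ((toFinite _).isCompact).union ?_
  exact isCompact_iUnion fun u => isCompact_iUnion fun v => isCompact_iUnion fun huv =>
    isCompact_arc (h.2 huv)

lemma isPreconnected_draw {H : X.G.Subgraph} (h : H ≤ X.compass)
    (hc : H.spanningCoe.ConnSet H.verts) : IsPreconnected (X.draw H) := by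
  rw [isPreconnected_iff_subset_of_disjoint]
  intro U W hU hW hsub hdis
  have harc : ∀ u v, H.Adj u v → X.arc u v ⊆ U ∨ X.arc u v ⊆ W := fun u v huv =>
    isPreconnected_iff_subset_of_disjoint.1 (isPreconnected_arc (h.2 huv)) U W hU hW
      ((arc_subset_draw huv).trans hsub)
      (subset_empty_iff.1 (hdis ▸ inter_subset_inter_left _ (arc_subset_draw huv)))
  have hnot : ∀ x ∈ X.draw H, x ∈ U → x ∉ W := fun x hx hxU hxW =>
    (hdis ▸ (⟨hx, hxU, hxW⟩ : x ∈ X.draw H ∩ (U ∩ W)) : x ∈ (∅ : Set Pt2))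
  by_cases h1 : ∃ v ∈ H.verts, X.pos v ∈ U
  · by_cases h2 : ∃ v ∈ H.verts, X.pos v ∉ U
    · obtain ⟨v, hv, hvU⟩ := h1
      obtain ⟨w, hw, hwU⟩ := h2
      obtain ⟨a, ⟨ha, haU⟩, b, ⟨hb, hbU⟩, hab⟩ := hc.2 {v | X.pos v ∈ U} ⟨v, hv, hvU⟩ ⟨w, hw, hwU⟩
      rcases harc a b hab with h3 | h3
      · exact absurd (h3 (pos_right_mem_arc (h.2 hab))) hbU
      · exact absurd (h3 (pos_left_mem_arc (h.2 hab))) (hnot _ (pos_mem_draw ha) haU)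
    · push Not at h2
      left
      intro x hx
      rcases mem_draw.1 hx with ⟨v, hv, rfl⟩ | ⟨u, v, huv, hx'⟩
      · exact h2 v hv
      · rcases harc u v huv with h3 | h3
        · exact h3 hx'
        · exact absurd (h3 (pos_left_mem_arc (h.2 huv)))
            (hnot _ (pos_mem_draw (H.edge_vert huv)) (h2 u (H.edge_vert huv)))
  · push Not at h1
    right
    intro x hx
    rcases mem_draw.1 hx with ⟨v, hv, rfl⟩ | ⟨u, v, huv, hx'⟩
    · exact (hsub hx).resolve_left (h1 v hv)
    · rcases harc u v huv with h3 | h3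
      · exact absurd (h3 (pos_left_mem_arc (h.2 huv))) (h1 u (H.edge_vert huv))
      · exact h3 hx'

lemma mem_verts_of_pos_mem_draw {H : X.G.Subgraph} (h : H ≤ X.compass) {v : V}
    (hv : v ∈ X.compass.verts) (hx : X.pos v ∈ X.draw H) : v ∈ H.verts := by
  rcases mem_draw.1 hx with ⟨w, hw, he⟩ | ⟨a, b, hab, hx⟩
  · rwa [← X.posInj (h.1 hw) hv he]
  · rcases X.arcMeetsVerts a b v (h.2 hab) hv hx with rfl | rfl
    · exact H.edge_vert hab
    · exact H.edge_vert hab.symm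

/-- Two edge-disjoint subgraphs of the compass meet only in drawings of common vertices. -/
lemma draw_inter_draw {H₁ H₂ : X.G.Subgraph} (h₁ : H₁ ≤ X.compass) (h₂ : H₂ ≤ X.compass)
    (hE : ∀ u v, H₁.Adj u v → ¬ H₂.Adj u v) :
    X.draw H₁ ∩ X.draw H₂ ⊆ X.pos '' (H₁.verts ∩ H₂.verts) := by
  rintro x ⟨hx₁, hx₂⟩
  rcases mem_draw.1 hx₁ with ⟨v, hv, rfl⟩ | ⟨a, b, hab, ha⟩
  · exact ⟨v, ⟨hv, mem_verts_of_pos_mem_draw h₂ (h₁.1 hv) hx₂⟩, rfl⟩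
  · rcases mem_draw.1 hx₂ with ⟨v, hv, rfl⟩ | ⟨c, d, hcd, hc⟩
    · exact ⟨v, ⟨mem_verts_of_pos_mem_draw h₁ (h₂.1 hv) hx₁, hv⟩, rfl⟩
    · have hne : s(a, b) ≠ s(c, d) := by
        intro h
        rcases Sym2.eq_iff.1 h with ⟨rfl, rfl⟩ | ⟨rfl, rfl⟩
        · exact hE _ _ hab hcd
        · exact hE _ _ hab hcd.symm
      obtain ⟨v, hv, rfl⟩ : ∃ v ∈ H₁.verts, X.pos v = x := by
        rcases (X.arcMeetsArcs a b c d (h₁.2 hab) (h₂.2 hcd) hne ⟨ha, hc⟩).1 with rfl | rfl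
        · exact ⟨a, H₁.edge_vert hab, rfl⟩
        · exact ⟨b, H₁.edge_vert hab.symm, rfl⟩
      exact ⟨v, ⟨hv, mem_verts_of_pos_mem_draw h₂ (h₁.1 hv) hx₂⟩, rfl⟩

lemma disjoint_draw {H₁ H₂ : X.G.Subgraph} (h₁ : H₁ ≤ X.compass) (h₂ : H₂ ≤ X.compass)
    (hV : Disjoint H₁.verts H₂.verts) : Disjoint (X.draw H₁) (X.draw H₂) := by
  rw [disjoint_iff_inter_eq_empty, ← subset_empty_iff]
  refine (draw_inter_draw h₁ h₂ fun u v h h' =>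
    hV.le_bot ⟨H₁.edge_vert h, H₂.edge_vert h'⟩).trans ?_
  rw [disjoint_iff_inter_eq_empty.1 hV, image_empty]

/-- The drawing of a path has continuous logarithms. -/
theorem isLogSet_draw_of_path [Finite V] (n : ℕ) : ∀ {H : X.G.Subgraph}, H.verts.ncard = n →
    H ≤ X.compass → H.spanningCoe.ConnSet H.verts → (∀ v ∈ H.verts, H.deg v ≤ 2) →
    (∃ v ∈ H.verts, H.deg v ≤ 1) → IsLogSet (X.draw H) := by
  induction n with
  | zero =>
    intro H hn _ hc
    exact absurd ((ncard_eq_zero (toFinite _)).1 hn) hc.1.ne_empty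
  | succ n ih =>
    intro H hn hle hc h2 hex
    obtain ⟨v, hv, hv1⟩ := hex
    by_cases hne : (H.verts \ {v}).Nonempty
    · obtain ⟨w, hw, hvw⟩ := hc.exists_adj hv hne
      have hvw' : H.Adj v w := hvw
      have huniq : ∀ u, H.Adj v u → u = w := fun u hu =>
        Subgraph.eq_of_adj_of_deg_le_one hv1 hu hvw
      have hlt : H.deleteVerts {v} ≤ H := Subgraph.deleteVerts_le
      have hadj : ∀ a b, H.Adj a b → a ≠ v → b ≠ v → (H.deleteVerts {v}).Adj a b :=
        fun a b hab ha hb => Subgraph.deleteVerts_adj.2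
          ⟨H.edge_vert hab, ha, H.edge_vert hab.symm, hb, hab⟩
      have hc' : (H.deleteVerts {v}).spanningCoe.ConnSet (H.deleteVerts {v}).verts := by
        have h := hc.diff_singleton (v := v)
          (fun a _ b _ ha hb hab => absurd ((huniq a ha).trans (huniq b hb).symm) hab) hne
        refine ⟨h.1, fun T h1 h2 => ?_⟩
        obtain ⟨a, ha, b, hb, hab⟩ := h.2 T h1 h2
        exact ⟨a, ha, b, hb, hadj a b hab ha.1.2 hb.1.2⟩
      have hlog := ih (H := H.deleteVerts {v}) (by
          rw [Subgraph.deleteVerts_verts, ncard_sdiff_singleton_of_mem hv, hn]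
          rfl) (hlt.trans hle) hc'
        (fun u hu => (Subgraph.deg_mono hlt u).trans (h2 u (hlt.1 hu)))
        ⟨w, ⟨hw, hvw'.ne.symm⟩, by
          have h1 : (H.deleteVerts {v}).neighborSet w ⊆ H.neighborSet w \ {v} := by
            intro u hu
            have := Subgraph.deleteVerts_adj.1 hu
            exact ⟨this.2.2.2.2, this.2.2.2.1⟩
          have h3 := ncard_sdiff_singleton_of_mem (s := H.neighborSet w) (a := v) hvw'.symm
          have h4 := ncard_le_ncard h1 (toFinite _)
          have h5 := h2 w hw
          unfold Subgraph.deg at *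
          omega⟩
      have hdraw : X.draw H ⊆ X.arc v w ∪ X.draw (H.deleteVerts {v}) := by
        intro x hx
        rcases mem_draw.1 hx with ⟨u, hu, rfl⟩ | ⟨a, b, hab, hx⟩
        · by_cases huv : v = u
          · subst huv
            exact Or.inl (pos_left_mem_arc (hle.2 hvw'))
          · exact Or.inr (pos_mem_draw ⟨hu, fun h => huv h.symm⟩)
        · by_cases hav : a = v
          · subst hav
            rw [huniq b hab] at hx
            exact Or.inl hx
          · by_cases hbv : b = v
            · subst hbv
              rw [huniq a hab.symm, X.arcSymm] at hx
              exact Or.inl hx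
            · exact Or.inr (arc_subset_draw (hadj a b hab hav hbv) hx)
      have hsub : X.arc v w ⊆ X.draw H := arc_subset_draw hvw'
      have hinter : X.arc v w ∩ X.draw (H.deleteVerts {v}) = {X.pos w} := by
        refine subset_antisymm ?_ (singleton_subset_iff.2
          ⟨pos_right_mem_arc (hle.2 hvw'), pos_mem_draw ⟨hw, hvw'.ne.symm⟩⟩)
        have hE : X.arc v w ⊆ X.draw (X.G.subgraphOfAdj (H.adj_sub hvw')) :=
          arc_subset_draw (by simp)
        have hS : X.G.subgraphOfAdj (H.adj_sub hvw') ≤ X.compass :=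
          subgraphOfAdj_le_of_adj X.compass (hle.2 hvw')
        refine (inter_subset_inter_left _ hE).trans
          ((draw_inter_draw hS (hlt.trans hle) ?_).trans ?_)
        · intro a b hab hab'
          have h1 := Subgraph.deleteVerts_adj.1 hab'
          simp only [subgraphOfAdj_adj, Sym2.eq_iff] at hab
          rcases hab with ⟨rfl, rfl⟩ | ⟨rfl, rfl⟩
          · exact h1.2.1 rfl
          · exact h1.2.2.2.1 rfl
        · rintro _ ⟨u, ⟨hu1, -, hu2⟩, rfl⟩
          rcases hu1 with rfl | rfl
          · exact absurd rfl hu2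
          · rfl
      intro f hf hf0
      have hf' := hf.mono hsub
      refine HasLog.mono (HasLog.union (isLogSet_arc (hle.2 hvw') f (hf.mono hsub)
        (fun z hz => hf0 z (hsub hz))) (hlog f (hf.mono (draw_mono hlt))
        (fun z hz => hf0 z (draw_mono hlt hz))) (isCompact_arc (hle.2 hvw')).isClosed
        (isCompact_draw (hlt.trans hle)).isClosed ?_) hdraw
      rw [hinter]
      exact isPreconnected_singleton
    · have hV : ∀ u ∈ H.verts, u = v := fun u hu => by_contra fun h => hne ⟨u, hu, h⟩
      have hd : X.draw H ⊆ {X.pos v} := by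
        intro x hx
        rcases mem_draw.1 hx with ⟨u, hu, rfl⟩ | ⟨a, b, hab, -⟩
        · rw [hV u hu]
          rfl
        · exact absurd ((hV a (H.edge_vert hab)).trans (hV b (H.edge_vert hab.symm)).symm) hab.ne
      intro f hf hf0
      exact ⟨fun _ => Complex.log (f (X.pos v)), continuousOn_const, fun z hz => by
        rw [Complex.exp_log (hf0 _ (pos_mem_draw hv)), hd hz]⟩

end PDE

/-! ### Nested cycles -/

namespace PDE

open SimpleGraph

variable {V : Type} [Finite V] {X : PDE V}

/-- An open set contained in the closure of a domain bounded by a cycle does not meet the cycle. -/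
theorem disjoint_draw_of_subset_closure {C : X.G.Subgraph} (hC : C.IsCycleGraph)
    (hle : C ≤ X.compass) {U D : Set Pt2} (hU : IsOpen U) (hb : Bornology.IsBounded U)
    (hfr : frontier U = X.draw C) (hDo : IsOpen D) (hD : D ⊆ closure U) :
    Disjoint D (X.draw C) := by
  rw [Set.disjoint_left]
  intro x₀ hx₀D hx₀
  obtain ⟨u, v, huv, hx₀a⟩ : ∃ u v, C.Adj u v ∧ x₀ ∈ X.arc u v := by
    rcases mem_draw.1 hx₀ with ⟨u, hu, rfl⟩ | h
    · obtain ⟨v, huv⟩ := hC.exists_adj hu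
      exact ⟨u, v, huv, pos_left_mem_arc (hle.2 huv)⟩
    · exact h
  obtain ⟨f, hf, hinj, he, h0, h1⟩ := X.arcIsArc u v (hle.2 huv)
  have harc : ∀ s ∈ Icc (0 : ℝ) 1, f s ∈ X.arc u v := fun s hs => he ▸ mem_image_of_mem f hs
  obtain ⟨t, ht, htD⟩ : ∃ t ∈ Ioo (0 : ℝ) 1, f t ∈ D := by
    rw [← he] at hx₀a
    obtain ⟨t₀, ht₀, rfl⟩ := hx₀a
    have hcl : t₀ ∈ closure (Ioo (0 : ℝ) 1) := by rwa [closure_Ioo (by norm_num)]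
    have : (nhdsWithin t₀ (Ioo 0 1)).NeBot := mem_closure_iff_nhdsWithin_neBot.1 hcl
    have hev : ∀ᶠ t in nhdsWithin t₀ (Ioo 0 1), f t ∈ D :=
      ((hf t₀ ht₀).mono Ioo_subset_Icc_self).eventually (hDo.mem_nhds hx₀D)
    obtain ⟨t, h1, h2⟩ := (hev.and self_mem_nhdsWithin).exists
    exact ⟨t, h2, h1⟩
  obtain ⟨a, b, hat, htb, hab, habD⟩ : ∃ a b, a < t ∧ t < b ∧ Icc a b ⊆ Icc 0 1 ∧
      ∀ s ∈ Icc a b, f s ∈ D := by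
    have h2 : ∀ᶠ s in nhds t, s ∈ Icc (0 : ℝ) 1 ∧ f s ∈ D :=
      Filter.Eventually.and (Icc_mem_nhds ht.1 ht.2)
        ((hf.continuousAt (Icc_mem_nhds ht.1 ht.2)).eventually (hDo.mem_nhds htD))
    obtain ⟨ε, hε, hεs⟩ := Metric.nhds_basis_closedBall.mem_iff.1 h2
    rw [Real.closedBall_eq_Icc] at hεs
    exact ⟨t - ε, t + ε, by linarith, by linarith, fun s hs => (hεs hs).1,
      fun s hs => (hεs hs).2⟩
  have ha0 : 0 ≤ a := (hab ⟨le_rfl, (hat.trans htb).le⟩).1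
  have hb1 : b ≤ 1 := (hab ⟨(hat.trans htb).le, le_rfl⟩).2
  set P := C.deleteEdges {s(u, v)} with hP
  have hPC : P ≤ C := Subgraph.deleteEdges_le _
  have hPle : P ≤ X.compass := hPC.trans hle
  have hPlog : IsLogSet (X.draw P) := isLogSet_draw_of_path _ rfl hPle
    (hC.connSet_deleteEdges huv) hC.deg_deleteEdges_le ⟨u, C.edge_vert huv,
      hC.deg_deleteEdges_left huv⟩
  have hPadj : ∀ c d, C.Adj c d → s(c, d) ≠ s(u, v) → P.Adj c d := fun c d hcd hne =>
    (Subgraph.deleteEdges_adj ..).2 ⟨hcd, by simpa using hne⟩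
  have hends : ∀ s ∈ Icc (0 : ℝ) 1, f s ∈ X.draw P → s = 0 ∨ s = 1 := by
    intro s hs hsP
    have hE : X.arc u v ⊆ X.draw (X.G.subgraphOfAdj (C.adj_sub huv)) :=
      arc_subset_draw (by simp)
    have hS : X.G.subgraphOfAdj (C.adj_sub huv) ≤ X.compass :=
      subgraphOfAdj_le_of_adj X.compass (hle.2 huv)
    obtain ⟨w, ⟨hw, -⟩, hws⟩ := draw_inter_draw hS hPle (by
      intro c d hcd hcd'
      exact ((Subgraph.deleteEdges_adj ..).1 hcd').2 (by simpa [eq_comm] using hcd))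
      ⟨hE (harc s hs), hsP⟩
    rcases hw with rfl | rfl
    · exact Or.inl (hinj hs ⟨le_rfl, zero_le_one⟩ (by rw [← hws, h0]))
    · exact Or.inr (hinj hs ⟨zero_le_one, le_rfl⟩ (by rw [← hws, h1]))
  have hA : ∀ c d : ℝ, 0 ≤ c → d ≤ 1 → Icc c d ⊆ Icc (0 : ℝ) 1 := fun c d hc hd =>
    Icc_subset_Icc hc hd
  have hcpt : ∀ c d : ℝ, 0 ≤ c → d ≤ 1 → IsCompact (f '' Icc c d) := fun c d hc hd =>
    isCompact_Icc.image_of_continuousOn (hf.mono (hA c d hc hd))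
  have hlog : ∀ c d : ℝ, 0 ≤ c → d ≤ 1 → t ∉ Icc c d → LogAround (f '' Icc c d) (f t) := by
    intro c d hc hd ht'
    refine ((IsLogSet.Icc c d).image isCompact_Icc (hf.mono (hA c d hc hd))
      (hinj.mono (hA c d hc hd))).logAround ?_
    rintro ⟨s, hs, hst⟩
    exact ht' (hinj (hA c d hc hd hs) ⟨ht.1.le, ht.2.le⟩ hst ▸ hs)
  have hloga := hlog 0 a le_rfl (by linarith [ht.2]) (fun h => by linarith [h.2])
  have hlogb := hlog b 1 (by linarith [ht.1]) le_rfl (fun h => by linarith [h.1])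
  have hlogP : LogAround (X.draw P) (f t) := hPlog.logAround (fun h => by
    rcases hends t ⟨ht.1.le, ht.2.le⟩ h with h | h
    · exact ht.1.ne' h
    · exact ht.2.ne h)
  have hca := (hcpt 0 a le_rfl (by linarith [ht.2])).isClosed
  have hcb := (hcpt b 1 (by linarith [ht.1]) le_rfl).isClosed
  have hcP := (isCompact_draw hPle).isClosed
  have hint1 : X.draw P ∩ f '' Icc 0 a = {X.pos u} := by
    refine subset_antisymm ?_ (singleton_subset_iff.2
      ⟨pos_mem_draw (C.edge_vert huv), 0, ⟨le_rfl, ha0⟩, h0⟩)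
    rintro _ ⟨hx, s, hs, rfl⟩
    rcases hends s ⟨hs.1, by linarith [hs.2, ht.2]⟩ hx with rfl | rfl
    · exact h0
    · linarith [hs.2, ht.2]
  have hint2 : (X.draw P ∪ f '' Icc 0 a) ∩ f '' Icc b 1 = {X.pos v} := by
    refine subset_antisymm ?_ (singleton_subset_iff.2
      ⟨Or.inl (pos_mem_draw (C.edge_vert huv.symm)), 1, ⟨hb1, le_rfl⟩, h1⟩)
    rintro _ ⟨hx | ⟨s', hs', hss⟩, s, hs, rfl⟩
    · rcases hends s ⟨by linarith [hs.1, ht.1], hs.2⟩ hx with rfl | rfl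
      · linarith [hs.1, ht.1]
      · exact h1
    · have := hinj (hA 0 a le_rfl (by linarith [ht.2]) hs')
        (hA b 1 (by linarith [ht.1]) le_rfl hs) hss
      linarith [hs'.2, hs.1]
  have hY := (hlogP.union hloga hcP hca (by rw [hint1]; exact isPreconnected_singleton)).union hlogb
    (hcP.union hca) hcb (by rw [hint2]; exact isPreconnected_singleton)
  have hWb : Bornology.IsBounded (U ∪ D) := hb.closure.subset (union_subset subset_closure hD)
  refine not_logAround_of_frontier_subset hWb ((hcP.union hca).union hcb) ?_ (Or.inr htD) hY
  intro x hx
  have hxc : x ∈ closure U := closure_minimal (union_subset subset_closure hD) isClosed_closure hx.1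
  rw [frontier, (hU.union hDo).interior_eq] at hx
  have hxU : x ∉ U := fun h => hx.2 (Or.inl h)
  have hxD : x ∉ D := fun h => hx.2 (Or.inr h)
  have hxC : x ∈ X.draw C := by
    rw [← hfr, frontier, hU.interior_eq]
    exact ⟨hxc, hxU⟩
  rcases mem_draw.1 hxC with ⟨w, hw, rfl⟩ | ⟨c, d, hcd, hx'⟩
  · exact Or.inl (Or.inl (pos_mem_draw hw))
  · by_cases hne : s(c, d) = s(u, v)
    · have hx'' : x ∈ X.arc u v := by
        rcases Sym2.eq_iff.1 hne with ⟨rfl, rfl⟩ | ⟨rfl, rfl⟩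
        · exact hx'
        · rwa [X.arcSymm]
      rw [← he] at hx''
      obtain ⟨s, hs, rfl⟩ := hx''
      rcases lt_or_ge s a with hsa | hsa
      · exact Or.inl (Or.inr ⟨s, ⟨hs.1, hsa.le⟩, rfl⟩)
      · rcases lt_or_ge b s with hsb | hsb
        · exact Or.inr ⟨s, ⟨hsb.le, hs.2⟩, rfl⟩
        · exact absurd (habD s ⟨hsa, hsb⟩) hxD
    · exact Or.inl (Or.inl (arc_subset_draw (hPadj c d hcd hne) hx'))

end PDE

namespace NestedCycles

open SimpleGraph PDE

variable {V : Type} {X : PDE V} {r : ℕ} (N : NestedCycles X r) {i j : ℕ}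

lemma isOpen_D (hi : i ∈ Icc 1 r) : IsOpen (N.D i) := (N.diskOpen i hi).isOpen

lemma isBounded_D (hi : i ∈ Icc 1 r) : Bornology.IsBounded (N.D i) :=
  X.diskΔ.isCompact.isBounded.subset (N.diskSub i hi)

lemma closure_D (hi : i ∈ Icc 1 r) : closure (N.D i) = N.D i ∪ X.draw (N.C i) := by
  rw [closure_eq_self_union_frontier, N.diskBd i hi]

lemma disjoint_D_draw (hi : i ∈ Icc 1 r) : Disjoint (N.D i) (X.draw (N.C i)) := by
  rw [← N.diskBd i hi]
  exact (disjoint_frontier_iff_isOpen.2 (N.isOpen_D hi)).symm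

lemma draw_subset_D (hi : i ∈ Icc 1 r) (hj : j ∈ Icc 1 r) (hij : i < j) :
    X.draw (N.C j) ⊆ N.D i := by
  have h1 : X.draw (N.C j) ⊆ closure (N.D i) := by
    rw [← N.diskBd j hj]
    exact frontier_subset_closure.trans (closure_mono (N.nested i j hi.1 hij.le hj.2))
  rw [N.closure_D hi] at h1
  intro x hx
  refine (h1 hx).resolve_right fun h => ?_
  exact (disjoint_draw (N.cycLe i hi) (N.cycLe j hj) (N.cycDisj i hi j hj hij.ne)).le_bot ⟨h, hx⟩

lemma disjoint_D_draw_of_le (hi : i ∈ Icc 1 r) (hj : j ∈ Icc 1 r) (hij : i ≤ j) :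
    Disjoint (N.D j) (X.draw (N.C i)) :=
  (N.disjoint_D_draw hi).mono_left (N.nested i j hi.1 hij hj.2)

variable {N} {D : Set Pt2}

lemma disjoint_hole_last (hr : 1 ≤ r) (hDo : IsOpen D) (hD : D ⊆ N.ann) :
    Disjoint D (X.draw (N.C r)) := by
  have h1 : Disjoint D (closure (N.D r)) := by
    refine Disjoint.closure_right ?_ hDo
    rw [Set.disjoint_left]
    exact fun x hx => (hD hx).2
  refine h1.mono_right ?_
  rw [← N.diskBd r ⟨hr, le_rfl⟩]
  exact frontier_subset_closure

lemma disjoint_hole_first [Finite V] (hr : 1 ≤ r) (hDo : IsOpen D) (hD : D ⊆ N.ann) :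
    Disjoint D (X.draw (N.C 1)) :=
  have h1 : 1 ∈ Icc 1 r := ⟨le_rfl, hr⟩
  disjoint_draw_of_subset_closure (N.cyc 1 h1) (N.cycLe 1 h1) (N.isOpen_D h1) (N.isBounded_D h1)
    (N.diskBd 1 h1) hDo (hD.trans sdiff_subset)

lemma hole_subset_D [Finite V] (hr : 1 ≤ r) (hDo : IsOpen D) (hD : D ⊆ N.ann) : D ⊆ N.D 1 := by
  intro x hx
  have h1 := (hD hx).1
  rw [N.closure_D ⟨le_rfl, hr⟩] at h1
  exact h1.resolve_right fun h => (disjoint_hole_first hr hDo hD).le_bot ⟨hx, h⟩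

end NestedCycles

/-! ### Streams -/

namespace NestedCycles

open SimpleGraph PDE

variable {V : Type} [Finite V] {X : PDE V} {r : ℕ}

/-- The vertices of `P` off the first and the last cycle. -/
def inner (N : NestedCycles X r) (P : X.G.Subgraph) : Set V :=
  (P.verts \ (N.C 1).verts) \ (N.C r).verts

/-- `P` is a path of the compass that crosses the annulus from `a` to `b`. -/
structure IsCrossing (N : NestedCycles X r) (P : X.G.Subgraph) (a b : V) : Prop where
  le : P ≤ X.compass
  subset_ann : X.draw P ⊆ N.ann
  conn : P.spanningCoe.ConnSet P.verts
  ne : a ≠ b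
  deg_le : ∀ v ∈ P.verts, P.deg v ≤ 2
  ends_eq : P.ends = {a, b}
  first_eq : P.verts ∩ (N.C 1).verts = {a}
  last_eq : P.verts ∩ (N.C r).verts = {b}

variable {N : NestedCycles X r}

omit [Finite V] in
lemma one_mem (hr : 1 ≤ r) : 1 ∈ Icc 1 r := ⟨le_rfl, hr⟩

omit [Finite V] in
lemma last_mem (hr : 1 ≤ r) : r ∈ Icc 1 r := ⟨hr, le_rfl⟩

theorem _root_.IsStreamBetween.exists_isCrossing {L P : X.G.Subgraph} (hr : 1 ≤ r)
    (h : IsStreamBetween N L 1 r P) : ∃ a b, N.IsCrossing P a b := by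
  obtain ⟨⟨-, ⟨-, hconn, hdeg, -⟩, -⟩, hann, a, b, hab, hends, h1, h2⟩ := h
  have hconn := Subgraph.connSet_verts hconn
  rw [Subgraph.verts_inf] at h1 h2
  have ha : a ∈ P.verts ∩ (N.C 1).verts := h1 ▸ rfl
  have hb : b ∈ P.verts ∩ (N.C r).verts := h2 ▸ rfl
  have hm1 := one_mem hr
  have hda : P.deg a ≤ 1 := (hends ▸ Or.inl rfl : a ∈ P.ends).2
  have key : ∀ u ∈ P.verts, u ≠ a → u ∈ X.compass.verts → X.pos u ∈ interior X.Δ := by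
    intro u hu hua huc
    have h3 : X.pos u ∈ closure (N.D 1) := (hann (pos_mem_draw hu)).1
    rw [N.closure_D hm1] at h3
    refine interior_maximal (N.diskSub 1 hm1) (N.isOpen_D hm1) (h3.resolve_right fun h3 => hua ?_)
    have : u ∈ P.verts ∩ (N.C 1).verts := ⟨hu, mem_verts_of_pos_mem_draw (N.cycLe 1 hm1) huc h3⟩
    rwa [h1] at this
  have hac := (N.cycLe 1 hm1).1 ha.2
  have hbc := (N.cycLe r (last_mem hr)).1 hb.2
  have hverts : P.verts ⊆ X.compass.verts := by
    by_contra! hnot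
    obtain ⟨v, hv, hvc⟩ := not_subset.1 hnot
    have hS := hconn.diff_singleton (v := a)
      (fun c _ d _ hc hd hcd => absurd (Subgraph.eq_of_adj_of_deg_le_one hda hc hd) hcd)
      ⟨b, hb.1, hab.symm⟩
    obtain ⟨u, ⟨⟨hu, hua⟩, huc⟩, w, ⟨-, hwc⟩, huw⟩ := hS.2 X.compass.verts
      ⟨b, ⟨hb.1, hab.symm⟩, hbc⟩ ⟨v, ⟨hv, fun hva => hvc (hva ▸ hac)⟩, hvc⟩
    exact hwc (X.separation u w (P.adj_sub huw) huc (key u hu hua huc)).1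
  refine ⟨a, b, ⟨hverts, fun u w huw => ?_⟩, hann, hconn, hab, hdeg, hends, h1, h2⟩
  by_cases hua : u = a
  · have hwa : w ≠ a := fun h => huw.ne (hua.trans h.symm)
    have hw := P.edge_vert huw.symm
    exact (X.separation w u (P.adj_sub huw.symm) (hverts hw) (key w hw hwa (hverts hw))).2.symm
  · have hu := P.edge_vert huw
    exact (X.separation u w (P.adj_sub huw) (hverts hu) (key u hu hua (hverts hu))).2

namespace IsCrossing

variable {P : X.G.Subgraph} {a b : V} (h : N.IsCrossing P a b)

include h

omit [Finite V] in
lemma left_mem : a ∈ P.verts ∩ (N.C 1).verts := h.first_eq ▸ rfl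

omit [Finite V] in
lemma right_mem : b ∈ P.verts ∩ (N.C r).verts := h.last_eq ▸ rfl

omit [Finite V] in
lemma mem_inner {v : V} : v ∈ N.inner P ↔ v ∈ P.verts ∧ v ≠ a ∧ v ≠ b := by
  have h1 := Set.ext_iff.1 h.first_eq v
  have h2 := Set.ext_iff.1 h.last_eq v
  simp only [mem_inter_iff, mem_singleton_iff] at h1 h2
  simp only [inner, mem_sdiff]
  tauto

omit [Finite V] in
lemma deg_left : P.deg a ≤ 1 := (h.ends_eq ▸ Or.inl rfl : a ∈ P.ends).2

omit [Finite V] in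
lemma deg_right : P.deg b ≤ 1 := (h.ends_eq ▸ Or.inr rfl : b ∈ P.ends).2

omit [Finite V] in
lemma deg_inner {v : V} (hv : v ∈ N.inner P) : P.deg v = 2 := by
  obtain ⟨hv, hva, hvb⟩ := h.mem_inner.1 hv
  refine le_antisymm (h.deg_le v hv) ?_
  by_contra! hlt
  have : v ∈ P.ends := ⟨hv, by omega⟩
  rw [h.ends_eq] at this
  rcases this with rfl | rfl
  · exact hva rfl
  · exact hvb rfl

lemma connSet_diff_left : P.spanningCoe.ConnSet (P.verts \ {a}) :=
  h.conn.diff_singleton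
    (fun _ _ _ _ hc hd hcd => absurd (Subgraph.eq_of_adj_of_deg_le_one h.deg_left hc hd) hcd)
    ⟨b, h.right_mem.1, h.ne.symm⟩

lemma connSet_diff_right : P.spanningCoe.ConnSet (P.verts \ {b}) :=
  h.conn.diff_singleton
    (fun _ _ _ _ hc hd hcd => absurd (Subgraph.eq_of_adj_of_deg_le_one h.deg_right hc hd) hcd)
    ⟨a, h.left_mem.1, h.ne⟩

variable (hne : (N.inner P).Nonempty)

include hne

lemma connSet_inner : P.spanningCoe.ConnSet (N.inner P) := by
  have heq : N.inner P = (P.verts \ {a}) \ {b} := by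
    ext v
    rw [h.mem_inner]
    simp [and_assoc]
  rw [heq] at hne ⊢
  exact h.connSet_diff_left.diff_singleton
    (fun _ _ _ _ hc hd hcd => absurd (Subgraph.eq_of_adj_of_deg_le_one h.deg_right hc hd) hcd) hne

lemma exists_adj_left : ∃ v ∈ N.inner P, P.Adj a v := by
  obtain ⟨v, hv⟩ := hne
  obtain ⟨hv1, hv2, hv3⟩ := h.mem_inner.1 hv
  obtain ⟨u, hu, hau⟩ := h.connSet_diff_right.exists_adj ⟨h.left_mem.1, h.ne⟩ ⟨v, ⟨hv1, hv3⟩, hv2⟩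
  exact ⟨u, h.mem_inner.2 ⟨hu.1, hau.ne.symm, hu.2⟩, hau⟩

lemma exists_adj_right : ∃ v ∈ N.inner P, P.Adj b v := by
  obtain ⟨v, hv⟩ := hne
  obtain ⟨hv1, hv2, hv3⟩ := h.mem_inner.1 hv
  obtain ⟨u, hu, hau⟩ := h.connSet_diff_left.exists_adj ⟨h.right_mem.1, h.ne.symm⟩
    ⟨v, ⟨hv1, hv2⟩, hv3⟩
  exact ⟨u, h.mem_inner.2 ⟨hu.1, hu.2, hau.ne.symm⟩, hau⟩

lemma adj_mem_inner {u v : V} (huv : P.Adj u v) : u ∈ N.inner P ∨ v ∈ N.inner P := by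
  obtain ⟨x, hx, hax⟩ := h.exists_adj_left hne
  by_contra! hcon
  have hu : u = a ∨ u = b := by
    by_contra! hu
    exact hcon.1 (h.mem_inner.2 ⟨P.edge_vert huv, hu⟩)
  have hv : v = a ∨ v = b := by
    by_contra! hv
    exact hcon.2 (h.mem_inner.2 ⟨P.edge_vert huv.symm, hv⟩)
  rcases hu with rfl | rfl <;> rcases hv with rfl | rfl
  · exact huv.ne rfl
  · exact (h.mem_inner.1 hx).2.2 (Subgraph.eq_of_adj_of_deg_le_one h.deg_left hax huv)
  · exact (h.mem_inner.1 hx).2.2 (Subgraph.eq_of_adj_of_deg_le_one h.deg_left hax huv.symm)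
  · exact huv.ne rfl

end IsCrossing

/-- Two crossing paths of a linkage that share an inner vertex are nested. -/
lemma IsCrossing.le_of_mem_inner {L P Q : X.G.Subgraph} {a b c d v : V}
    (hL : ∀ w ∈ L.verts, L.deg w ≤ 2) (hPL : P ≤ L) (hQL : Q ≤ L) (hP : N.IsCrossing P a b)
    (hQ : N.IsCrossing Q c d) (hvP : v ∈ P.verts) (hvQ : v ∈ N.inner Q) : Q ≤ P := by
  have hsub : ∀ w, w ∈ P.verts → w ∈ N.inner Q → ∀ x, Q.Adj w x → P.Adj w x := by
    intro w hwP hwQ x hwx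
    have hwP' : w ∈ N.inner P := ⟨⟨hwP, hwQ.1.2⟩, hwQ.2⟩
    have heq : P.neighborSet w = L.neighborSet w :=
      eq_of_subset_of_ncard_le (fun _ hu => hPL.2 hu)
        ((hL w (hPL.1 hwP)).trans (hP.deg_inner hwP').ge) (toFinite _)
    have : x ∈ L.neighborSet w := hQL.2 hwx
    rwa [← heq] at this
  have hinner : N.inner Q ⊆ P.verts := by
    by_contra hnot
    obtain ⟨y, hy, hyP⟩ := not_subset.1 hnot
    obtain ⟨u, ⟨hu, huP⟩, w, ⟨hw, hwP⟩, huw⟩ := (hQ.connSet_inner ⟨v, hvQ⟩).2 P.verts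
      ⟨v, hvQ, hvP⟩ ⟨y, hy, hyP⟩
    exact hwP (P.edge_vert (hsub u huP hu w huw).symm)
  refine ⟨fun w hw => ?_, fun u w huw => ?_⟩
  · by_cases hwQ : w ∈ N.inner Q
    · exact hinner hwQ
    · have : w = c ∨ w = d := by
        by_contra! hcon
        exact hwQ (hQ.mem_inner.2 ⟨hw, hcon⟩)
      rcases this with rfl | rfl
      · obtain ⟨x, hx, hax⟩ := hQ.exists_adj_left ⟨v, hvQ⟩
        exact P.edge_vert (hsub x (hinner hx) hx _ hax.symm).symm
      · obtain ⟨x, hx, hax⟩ := hQ.exists_adj_right ⟨v, hvQ⟩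
        exact P.edge_vert (hsub x (hinner hx) hx _ hax.symm).symm
  · rcases hQ.adj_mem_inner ⟨v, hvQ⟩ huw with hu | hw
    · exact hsub u (hinner hu) hu w huw
    · exact (hsub w (hinner hw) hw u huw.symm).symm

/-- Distinct crossing paths of a linkage meet at most in their ends. -/
lemma IsCrossing.disjoint_inner {L P Q : X.G.Subgraph} {a b c d : V}
    (hL : ∀ w ∈ L.verts, L.deg w ≤ 2) (hPL : P ≤ L) (hQL : Q ≤ L) (hP : N.IsCrossing P a b)
    (hQ : N.IsCrossing Q c d) (hPQ : P ≠ Q) : Disjoint (N.inner P) Q.verts := by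
  rw [Set.disjoint_left]
  intro v hvP hvQ
  have hvQ' : v ∈ N.inner Q := ⟨⟨hvQ, hvP.1.2⟩, hvP.2⟩
  exact hPQ (le_antisymm (hQ.le_of_mem_inner hL hQL hPL hP hvQ hvP)
    (hP.le_of_mem_inner hL hPL hQL hQ hvP.1.1 hvQ'))

omit [Finite V] in
/-- A crossing path meets every cycle. -/
lemma IsCrossing.exists_mem {P : X.G.Subgraph} {a b : V} (h : N.IsCrossing P a b) {i : ℕ}
    (h1 : 1 < i) (h2 : i < r) : ∃ v ∈ N.inner P, v ∈ (N.C i).verts := by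
  have hm1 : 1 ∈ Icc 1 r := ⟨le_rfl, by omega⟩
  have hmi : i ∈ Icc 1 r := ⟨h1.le, h2.le⟩
  have hmr : r ∈ Icc 1 r := ⟨by omega, le_rfl⟩
  have hpre := isPreconnected_draw h.le h.conn
  obtain ⟨x, hxP, hx⟩ : (X.draw P ∩ frontier (N.D i)).Nonempty := by
    by_contra hne
    have hsub : X.draw P ⊆ N.D i ∪ (closure (N.D i))ᶜ := by
      intro x hx
      by_cases hxc : x ∈ closure (N.D i)
      · refine Or.inl (by_contra fun hxD => hne ⟨x, hx, hxc, ?_⟩)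
        rwa [(N.isOpen_D hmi).interior_eq]
      · exact Or.inr hxc
    obtain ⟨x, -, hx1, hx2⟩ := hpre (N.D i) _ (N.isOpen_D hmi) isClosed_closure.isOpen_compl hsub
      ⟨_, pos_mem_draw h.right_mem.1, N.draw_subset_D hmi hmr h2 (pos_mem_draw h.right_mem.2)⟩
      ⟨_, pos_mem_draw h.left_mem.1, fun hcl => by
        rw [N.closure_D hmi] at hcl
        rcases hcl with hcl | hcl
        · exact (N.disjoint_D_draw_of_le hm1 hmi h1.le).le_bot
            ⟨hcl, pos_mem_draw h.left_mem.2⟩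
        · exact (disjoint_draw (N.cycLe 1 hm1) (N.cycLe i hmi) (N.cycDisj 1 hm1 i hmi h1.ne)).le_bot
            ⟨pos_mem_draw h.left_mem.2, hcl⟩⟩
    exact hx2 (subset_closure hx1)
  rw [N.diskBd i hmi] at hx
  by_contra! hno
  refine (disjoint_draw h.le (N.cycLe i hmi) ?_).le_bot ⟨hxP, hx⟩
  rw [Set.disjoint_left]
  intro v hvP hvC
  refine hno v ⟨⟨hvP, fun hv => ?_⟩, fun hv => ?_⟩ hvC
  · exact (N.cycDisj 1 hm1 i hmi h1.ne).le_bot ⟨hv, hvC⟩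
  · exact (N.cycDisj r hmr i hmi h2.ne').le_bot ⟨hv, hvC⟩

end NestedCycles

/-! ### Essential segments of a cycle -/

/-- The edges of `C` with an end in `A`. -/
def SimpleGraph.Subgraph.star {V : Type*} {G : SimpleGraph V} (C : G.Subgraph) (A : Set V) :
    G.Subgraph where
  verts := {v | v ∈ A ∧ v ∈ C.verts ∨ ∃ u ∈ A, C.Adj u v}
  Adj u v := C.Adj u v ∧ (u ∈ A ∨ v ∈ A)
  adj_sub h := C.adj_sub h.1
  edge_vert := by
    rintro u v ⟨h, hu | hv⟩
    · exact Or.inl ⟨hu, C.edge_vert h⟩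
    · exact Or.inr ⟨v, hv, h.symm⟩
  symm := ⟨fun _ _ h => ⟨h.1.symm, h.2.symm⟩⟩

lemma SimpleGraph.Subgraph.star_le {V : Type*} {G : SimpleGraph V} (C : G.Subgraph) (A : Set V) :
    C.star A ≤ C := by
  refine ⟨?_, fun _ _ h => h.1⟩
  rintro v (hv | ⟨u, -, hv⟩)
  · exact hv.2
  · exact C.edge_vert hv.symm

namespace PDE

open SimpleGraph

variable {V : Type} [Finite V] {X : PDE V}

/-- If a preconnected set `E` containing the vertices of a cycle in `O` does not separate `p` from
infinity, then some segment of the cycle avoiding `O` separates `p` from infinity together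
with `E`. -/
theorem exists_segment {C : X.G.Subgraph} (hle : C ≤ X.compass) {U E : Set Pt2} {p : Pt2}
    (hb : Bornology.IsBounded U) (hfr : frontier U ⊆ X.draw C) (hp : p ∈ U) {O : Set V}
    (hEc : IsClosed E) (hEp : IsPreconnected E) (hOE : ∀ v ∈ O, v ∈ C.verts → X.pos v ∈ E)
    (hE : LogAround E p) (hEO : LogAround (E ∪ X.draw (C.induce (O ∩ C.verts))) p) :
    ∃ A ⊆ C.verts, C.spanningCoe.ConnSet A ∧ Disjoint A O ∧
      (∀ u ∈ A, ∀ v, C.Adj u v → v ∈ A ∨ v ∈ O) ∧ ¬ LogAround (E ∪ X.draw (C.star A)) p := by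
  classical
  by_contra! hcon
  let K : SimpleGraph V :=
    { Adj := fun u v => C.Adj u v ∧ u ∉ O ∧ v ∉ O
      symm := ⟨fun _ _ h => ⟨h.1.symm, h.2.2, h.2.1⟩⟩
      loopless := ⟨fun _ h => h.1.ne rfl⟩ }
  let A : K.ConnectedComponent → Set V := fun c => c.supp ∩ (C.verts \ O)
  have hmax : ∀ c, ∀ u ∈ A c, ∀ v, C.Adj u v → v ∈ A c ∨ v ∈ O := by
    rintro c u ⟨huc, -, huO⟩ v huv
    by_cases hvO : v ∈ O
    · exact Or.inr hvO
    · have hK : K.Adj u v := ⟨huv, huO, hvO⟩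
      exact Or.inl ⟨(c.mem_supp_congr_adj hK).1 huc, C.edge_vert huv.symm, hvO⟩
  have hconn : ∀ c, (A c).Nonempty → C.spanningCoe.ConnSet (A c) := by
    rintro c ⟨x, hx⟩
    have hc := connSet_supp c
    have hsub : c.supp ⊆ C.verts \ O := by
      by_contra hno
      obtain ⟨y, hy, hyn⟩ := not_subset.1 hno
      obtain ⟨u, -, v, ⟨-, hv⟩, huv⟩ := hc.2 (C.verts \ O) ⟨x, hx⟩ ⟨y, hy, hyn⟩
      exact hv ⟨C.edge_vert huv.1.symm, huv.2.2⟩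
    have : A c = c.supp := inter_eq_left.2 hsub
    rw [this]
    exact hc.mono (show K ≤ C.spanningCoe from fun _ _ h => h.1)
  let H : Option K.ConnectedComponent → X.G.Subgraph := fun o =>
    o.elim (C.induce (O ∩ C.verts)) fun c => C.star (A c)
  have hHle : ∀ o, H o ≤ X.compass := by
    rintro (_ | c)
    · exact (show C.induce (O ∩ C.verts) ≤ C from
        ⟨inter_subset_right, fun _ _ h => h.2.2⟩).trans hle
    · exact (C.star_le _).trans hle
  have key1 : ∀ c, X.draw (H none) ∩ X.draw (H (some c)) ⊆ E := by
    intro c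
    refine (draw_inter_draw (hHle _) (hHle _) ?_).trans ?_
    · rintro u v ⟨hu, hv, -⟩ ⟨-, h | h⟩
      · exact h.2.2 hu.1
      · exact h.2.2 hv.1
    · rintro _ ⟨v, ⟨hv, -⟩, rfl⟩
      exact hOE v hv.1 hv.2
  have key2 : ∀ c d, c ≠ d → X.draw (H (some c)) ∩ X.draw (H (some d)) ⊆ E := by
    intro c d hcd
    have hdisj : ∀ v, v ∈ A c → v ∈ A d → False := fun v hc hd =>
      hcd (hc.1.symm.trans hd.1)
    refine (draw_inter_draw (hHle _) (hHle _) ?_).trans ?_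
    · rintro u v ⟨huv, h⟩ ⟨-, h'⟩
      rcases h with h | h <;> rcases h' with h' | h'
      · exact hdisj _ h h'
      · exact hdisj _ h ((hmax d v h' u huv.symm).resolve_right h.2.2)
      · exact hdisj _ h ((hmax d u h' v huv).resolve_right h.2.2)
      · exact hdisj _ h h'
    · rintro _ ⟨v, ⟨hv1, hv2⟩, rfl⟩
      have hvC : v ∈ C.verts := (C.star_le _).1 hv1
      have hor : ∀ e, v ∈ (C.star (A e)).verts → v ∈ A e ∨ v ∈ O := by
        rintro e (h | ⟨u, hu, huv⟩)
        · exact Or.inl h.1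
        · exact hmax e u hu v huv
      rcases hor c hv1 with h | h
      · rcases hor d hv2 with h' | h'
        · exact (hdisj _ h h').elim
        · exact hOE v h' hvC
      · exact hOE v h hvC
  have : Fintype (Option K.ConnectedComponent) := Fintype.ofFinite _
  have hlog := HasLog.union_pieces (Y := fun o => X.draw (H o)) Finset.univ hE hEc hEp ?_
    (fun o _ => (isCompact_draw (hHle o)).isClosed) ?_
  · refine not_logAround_of_frontier_subset hb ?_ ?_ hp hlog
    · exact hEc.union (isClosed_biUnion_finset fun o _ => (isCompact_draw (hHle o)).isClosed)
    · have hmem : ∀ o, X.draw (H o) ⊆ E ∪ ⋃ i ∈ Finset.univ, X.draw (H i) := fun o =>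
        (subset_biUnion_of_mem (u := fun i => X.draw (H i)) (Finset.mem_coe.2
          (Finset.mem_univ o))).trans subset_union_right
      intro x hx
      rcases mem_draw.1 (hfr hx) with ⟨v, hv, rfl⟩ | ⟨u, v, huv, hx⟩
      · by_cases hvO : v ∈ O
        · exact Or.inl (hOE v hvO hv)
        · exact hmem (some (K.connectedComponentMk v)) (pos_mem_draw (Or.inl ⟨⟨rfl, hv, hvO⟩, hv⟩))
      · have hu := C.edge_vert huv
        have hv := C.edge_vert huv.symm
        by_cases huO : u ∈ O
        · by_cases hvO : v ∈ O
          · exact hmem none (arc_subset_draw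
              (show (C.induce (O ∩ C.verts)).Adj u v from ⟨⟨huO, hu⟩, ⟨hvO, hv⟩, huv⟩) hx)
          · exact hmem (some (K.connectedComponentMk v)) (arc_subset_draw
              (show (C.star (A _)).Adj u v from ⟨huv, Or.inr ⟨rfl, hv, hvO⟩⟩) hx)
        · exact hmem (some (K.connectedComponentMk u)) (arc_subset_draw
            (show (C.star (A _)).Adj u v from ⟨huv, Or.inl ⟨rfl, hu, huO⟩⟩) hx)
  · rintro (_ | c) -
    · exact hEO
    · by_cases hne : (A c).Nonempty
      · exact hcon (A c) (fun v hv => hv.2.1) (hconn c hne)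
          (Set.disjoint_left.2 fun v hv => hv.2.2) (hmax c)
      · have : X.draw (H (some c)) = ∅ := by
          rw [not_nonempty_iff_eq_empty] at hne
          refine eq_empty_of_forall_notMem fun x hx => ?_
          have h0 : ∀ v, v ∉ A c := fun v hv => by rw [hne] at hv; exact hv
          rcases mem_draw.1 hx with ⟨v, hv | ⟨u, hu, -⟩, -⟩ | ⟨u, v, huv, -⟩
          · exact h0 v hv.1
          · exact h0 u hu
          · exact huv.2.elim (h0 u) (h0 v)
        change HasLog _ (E ∪ X.draw (H (some c)))
        rwa [this, union_empty]
  · rintro (_ | c) - (_ | d) - hcd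
    · exact absurd rfl hcd
    · exact key1 d
    · rw [inter_comm]
      exact key1 c
    · exact key2 c d fun h => hcd (by rw [h])

end PDE

namespace NestedCycles

open SimpleGraph PDE

variable {V : Type} {X : PDE V} {r : ℕ} {N : NestedCycles X r}

/-- A compact set off a crossing path does not separate the innermost disk from infinity. -/
lemma IsCrossing.logAround {P : X.G.Subgraph} {a b : V} (h : N.IsCrossing P a b) (hr : 1 ≤ r)
    {Y : Set Pt2} (hY : IsCompact Y) (hYD : Y ⊆ N.D 1) (hYr : Disjoint Y (N.D r))
    (hYP : Disjoint Y (X.draw P)) {p : Pt2} (hp : p ∈ N.D r) : LogAround Y p := by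
  have hm1 := one_mem hr
  have hmr := last_mem hr
  have ha : X.pos a ∉ N.D 1 := fun ha =>
    (N.disjoint_D_draw hm1).le_bot ⟨ha, pos_mem_draw h.left_mem.2⟩
  have hlog : LogAround Y (X.pos a) := ((N.diskOpen 1 hm1).isLogSet.logAround ha).mono hYD
  have hb : X.pos b ∈ frontier (N.D r) := by
    rw [N.diskBd r hmr]
    exact pos_mem_draw h.right_mem.2
  have hins : IsPreconnected (insert (X.pos b) (N.D r)) :=
    (N.diskOpen r hmr).isPreconnected.subset_closure (subset_insert _ _)
      (insert_subset (frontier_subset_closure hb) subset_closure)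
  have hS : IsPreconnected (insert (X.pos b) (N.D r) ∪ X.draw P) :=
    hins.union (X.pos b) (mem_insert _ _) (pos_mem_draw h.right_mem.1)
      (isPreconnected_draw h.le h.conn)
  refine hlog.transport hY hS ?_ (Or.inr (pos_mem_draw h.left_mem.1)) (Or.inl (Or.inr hp))
  refine Disjoint.union_right ?_ hYP
  rw [Set.disjoint_left] at hYP hYr ⊢
  rintro x hx (rfl | hx')
  · exact hYP hx (pos_mem_draw h.right_mem.1)
  · exact hYr hx hx'

end NestedCycles

/-! ### Hubs -/

namespace NestedCycles

open SimpleGraph PDE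

variable {V : Type} {X : PDE V} {r : ℕ} {N : NestedCycles X r}

/-- `Z` is a family of crossing paths that avoid the hole `D` and share no inner vertices. -/
structure IsCrossingFamily (N : NestedCycles X r) (Z : Set X.G.Subgraph) (D : Set Pt2) :
    Prop where
  crossing : ∀ P ∈ Z, ∃ a b, N.IsCrossing P a b
  disjoint_inner : ∀ P ∈ Z, ∀ Q ∈ Z, P ≠ Q → Disjoint (N.inner P) Q.verts
  disjoint_hole : ∀ P ∈ Z, Disjoint D (X.draw P)

/-- A compact preconnected set `E` off all crossing paths containing the vertices of `B`,
among them all vertices of intermediate cycles in the hole, together with a subgraph `H` that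
joins `E` to the interior of the crossing path `R`. -/
structure IsHub (N : NestedCycles X r) (Z : Set X.G.Subgraph) (D : Set Pt2)
    (R : X.G.Subgraph) (E : Set Pt2) (B : Set V) (H : X.G.Subgraph) : Prop where
  isCompact : IsCompact E
  isPreconnected : IsPreconnected E
  subset_D : E ⊆ N.D 1
  disjoint_D : Disjoint E (N.D r)
  disjoint_draw : ∀ P ∈ Z, Disjoint E (X.draw P)
  pos_mem : ∀ v ∈ B, X.pos v ∈ E
  mem_of_hole : ∀ i ∈ Ioo 1 r, ∀ v ∈ (N.C i).verts, X.pos v ∈ D → v ∈ B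
  le : H ≤ X.compass
  adj : ∀ u v, H.Adj u v → u ∈ N.inner R ∨ v ∈ N.inner R
  inner_subset : N.inner R ⊆ H.verts
  mem_verts : ∀ v ∈ H.verts, v ∈ N.inner R ∨ X.pos v ∈ E
  draw_subset_D : X.draw H ⊆ N.D 1
  disjoint_draw_D : Disjoint (X.draw H) (N.D r)
  disjoint_draw_draw : ∀ P ∈ Z, P ≠ R → Disjoint (X.draw H) (X.draw P)
  isPreconnected_union : IsPreconnected (E ∪ X.draw H)

lemma mem_Icc_of_mem_Ioo {i : ℕ} (hi : i ∈ Ioo 1 r) : i ∈ Icc 1 r := ⟨hi.1.le, hi.2.le⟩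

lemma mem_inner_of_mem_cycle {P : X.G.Subgraph} {i : ℕ} (hi : i ∈ Ioo 1 r) {v : V}
    (hv : v ∈ (N.C i).verts) (hvP : v ∈ P.verts) : v ∈ N.inner P := by
  have hi' := mem_Icc_of_mem_Ioo hi
  have hr : 1 ≤ r := hi'.1.trans hi'.2
  exact ⟨⟨hvP, fun h => (N.cycDisj 1 (one_mem hr) i hi' hi.1.ne).le_bot ⟨h, hv⟩⟩,
    fun h => (N.cycDisj r (last_mem hr) i hi' hi.2.ne').le_bot ⟨h, hv⟩⟩

lemma draw_cycle_subset_ann {i : ℕ} (hi : i ∈ Ioo 1 r) : X.draw (N.C i) ⊆ N.ann := by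
  have hi' := mem_Icc_of_mem_Ioo hi
  have hr : 1 ≤ r := hi'.1.trans hi'.2
  intro x hx
  exact ⟨subset_closure (N.draw_subset_D (one_mem hr) hi' hi.1 hx),
    fun h => (N.disjoint_D_draw_of_le hi' (last_mem hr) hi.2.le).le_bot ⟨h, hx⟩⟩

lemma draw_subset_D_of_subset_ann (hr : 1 ≤ r) {H : X.G.Subgraph} (hle : H ≤ X.compass)
    (hann : X.draw H ⊆ N.ann) (hd : Disjoint H.verts (N.C 1).verts) : X.draw H ⊆ N.D 1 := by
  intro x hx
  have h := (hann hx).1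
  rw [N.closure_D (one_mem hr)] at h
  exact h.resolve_right fun h => (PDE.disjoint_draw hle (N.cycLe 1 (one_mem hr)) hd).le_bot ⟨hx, h⟩

lemma disjoint_D_of_subset_ann {Y : Set Pt2} (h : Y ⊆ N.ann) : Disjoint Y (N.D r) :=
  Set.disjoint_left.2 fun _ hx => (h hx).2

lemma induce_le {P : X.G.Subgraph} {S : Set V} (hS : S ⊆ P.verts) : P.induce S ≤ P :=
  ⟨hS, fun _ _ h => h.2.2⟩

lemma inner_subset (P : X.G.Subgraph) : N.inner P ⊆ P.verts := fun _ h => h.1.1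

lemma connSet_induce {P : X.G.Subgraph} {S : Set V} (hS : P.spanningCoe.ConnSet S) :
    (P.induce S).spanningCoe.ConnSet S := by
  refine ⟨hS.1, fun T h1 h2 => ?_⟩
  obtain ⟨u, hu, v, hv, huv⟩ := hS.2 T h1 h2
  exact ⟨u, hu, v, hv, hu.1, hv.1, huv⟩

variable {Z : Set X.G.Subgraph} {D : Set Pt2} (hZ : N.IsCrossingFamily Z D)

include hZ

lemma IsCrossingFamily.isHub_of_forall_notMem [Finite V] (hr : 2 < r) {R : X.G.Subgraph}
    (hR : R ∈ Z) (hD : ∀ i ∈ Ioo 1 r, ∀ v ∈ (N.C i).verts, X.pos v ∉ D) :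
    N.IsHub Z D R ∅ ∅ (R.induce (N.inner R)) := by
  obtain ⟨a, b, h⟩ := hZ.crossing R hR
  have hle : R.induce (N.inner R) ≤ R := induce_le (inner_subset R)
  have hann := (draw_mono hle).trans h.subset_ann
  obtain ⟨v, hv, -⟩ := h.exists_mem (i := 2) (by omega) hr
  exact
    { isCompact := isCompact_empty
      isPreconnected := isPreconnected_empty
      subset_D := empty_subset _
      disjoint_D := empty_disjoint _
      disjoint_draw := fun _ _ => empty_disjoint _
      pos_mem := fun _ h => h.elim
      mem_of_hole := fun i hi v hv hvD => (hD i hi v hv hvD).elim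
      le := hle.trans h.le
      adj := fun _ _ huv => Or.inl huv.1
      inner_subset := subset_rfl
      mem_verts := fun _ => Or.inl
      draw_subset_D := draw_subset_D_of_subset_ann (by omega) (hle.trans h.le) hann
        (Set.disjoint_left.2 fun _ hx => hx.1.2)
      disjoint_draw_D := disjoint_D_of_subset_ann hann
      disjoint_draw_draw := fun P hP hPR => by
        obtain ⟨_, _, hP'⟩ := hZ.crossing P hP
        exact PDE.disjoint_draw (hle.trans h.le) hP'.le (hZ.disjoint_inner R hR P hP hPR.symm)
      isPreconnected_union := by
        rw [empty_union]
        exact isPreconnected_draw (hle.trans h.le) (connSet_induce (h.connSet_inner ⟨v, hv⟩)) }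

/-- If a vertex of an intermediate cycle lies in the hole, then a segment of that cycle joins the
hole to the interior of a crossing path without meeting any crossing path. -/
lemma IsCrossingFamily.exists_isHub_of_mem [Finite V] (hne : Z.Nonempty) (hDo : IsOpenDisk D)
    (hDann : D ⊆ N.ann) {i : ℕ} (hi : i ∈ Ioo 1 r) {d : V} (hd : d ∈ (N.C i).verts)
    (hdD : X.pos d ∈ D) : ∃ R ∈ Z, ∃ E B H, N.IsHub Z D R E B H := by
  have hi' := mem_Icc_of_mem_Ioo hi
  have hr : 1 ≤ r := hi'.1.trans hi'.2
  have hCle := N.cycLe i hi'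
  set Q : Set V := {v | ∃ P ∈ Z, v ∈ N.inner P} with hQ
  have hdQ : d ∉ Q := by
    rintro ⟨P, hP, hdP⟩
    exact (hZ.disjoint_hole P hP).le_bot ⟨hdD, pos_mem_draw hdP.1.1⟩
  obtain ⟨B, ⟨hdB, hBsub, hBconn⟩, hBmax⟩ := (toFinite {S : Set V | d ∈ S ∧
    S ⊆ (N.C i).verts \ Q ∧ (N.C i).spanningCoe.ConnSet S}).exists_maximal
    ⟨{d}, rfl, singleton_subset_iff.2 ⟨hd, hdQ⟩, .singleton d⟩
  obtain ⟨b₀, hb₀, q, hq, R, hR, hqR, hbq⟩ : ∃ b₀ ∈ B, ∃ q, q ∈ (N.C i).verts ∧ ∃ R ∈ Z,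
      q ∈ N.inner R ∧ (N.C i).Adj b₀ q := by
    obtain ⟨P, hP⟩ := hne
    obtain ⟨_, _, hP'⟩ := hZ.crossing P hP
    obtain ⟨v, hvP, hvC⟩ := hP'.exists_mem hi.1 hi.2
    obtain ⟨u, hu, w, hw, huw⟩ := (N.cyc i hi').connSet.2 B ⟨d, hd, hdB⟩
      ⟨v, hvC, fun hvB => (hBsub hvB).2 ⟨P, hP, hvP⟩⟩
    have hwQ : w ∈ Q := by
      by_contra hwQ
      have := hBmax (y := B ∪ {w}) ⟨Or.inl hdB,
        union_subset hBsub (singleton_subset_iff.2 ⟨hw.1, hwQ⟩),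
        hBconn.union (.singleton w) ⟨u, hu.2, w, rfl, Or.inr huw⟩⟩ subset_union_left
      exact hw.2 (this (Or.inr rfl))
    obtain ⟨R, hR, hwR⟩ := hwQ
    exact ⟨u, hu.2, w, hw.1, R, hR, hwR, huw⟩
  obtain ⟨a, b, h⟩ := hZ.crossing R hR
  set Dv : Set V := {v | (∃ j ∈ Ioo 1 r, v ∈ (N.C j).verts) ∧ X.pos v ∈ D} with hDv
  obtain ⟨F, hFD, hvF, hFc, hFp⟩ := hDo.exists_compact_preconnected
    ((toFinite Dv).image X.pos) (by rintro _ ⟨v, hv, rfl⟩; exact hv.2)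
  have hBP : ∀ P ∈ Z, Disjoint B P.verts := fun P hP => Set.disjoint_left.2 fun v hv hvP =>
    (hBsub hv).2 ⟨P, hP, mem_inner_of_mem_cycle hi (hBsub hv).1 hvP⟩
  have hBC : (N.C i).induce B ≤ N.C i := induce_le fun v hv => (hBsub hv).1
  have hSC : X.G.subgraphOfAdj ((N.C i).adj_sub hbq) ≤ N.C i := subgraphOfAdj_le_of_adj _ hbq
  have hIR : R.induce (N.inner R) ≤ R := induce_le (inner_subset R)
  set H := R.induce (N.inner R) ⊔ X.G.subgraphOfAdj ((N.C i).adj_sub hbq) with hH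
  have hHle : H ≤ X.compass := sup_le (hIR.trans h.le) (hSC.trans hCle)
  have hHv : ∀ v ∈ H.verts, v ∈ N.inner R ∨ v = b₀ := by
    rintro v (hv | rfl | rfl)
    · exact Or.inl hv
    · exact Or.inr rfl
    · exact Or.inl hqR
  have hHann : X.draw H ⊆ N.ann := by
    intro x hx
    rcases mem_draw.1 hx with ⟨v, hv | hv, rfl⟩ | ⟨u, v, huv | huv, hx⟩
    · exact h.subset_ann (pos_mem_draw (hIR.1 hv))
    · exact draw_cycle_subset_ann hi (pos_mem_draw (hSC.1 hv))
    · exact h.subset_ann (arc_subset_draw (hIR.2 huv) hx)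
    · exact draw_cycle_subset_ann hi (arc_subset_draw (hSC.2 huv) hx)
  have hBD : X.draw ((N.C i).induce B) ⊆ N.ann := (draw_mono hBC).trans (draw_cycle_subset_ann hi)
  have hdF : X.pos d ∈ F := hvF (mem_image_of_mem _ ⟨⟨i, hi, hd⟩, hdD⟩)
  have hE : IsPreconnected (F ∪ X.draw ((N.C i).induce B)) := hFp.union (X.pos d) hdF
    (pos_mem_draw (H := (N.C i).induce B) hdB)
    (isPreconnected_draw (hBC.trans hCle) (connSet_induce hBconn))
  have hHconn : H.spanningCoe.ConnSet H.verts := by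
    have h1 : H.spanningCoe.ConnSet (N.inner R) :=
      (connSet_induce (h.connSet_inner ⟨q, hqR⟩)).mono (Subgraph.spanningCoe_mono le_sup_left)
    have h2 := h1.union (.singleton b₀) ⟨q, hqR, b₀, rfl, Or.inr (Or.inr (by simp))⟩
    convert h2 using 1
    refine subset_antisymm hHv (union_subset (fun v hv => Or.inl hv) ?_)
    rintro _ rfl
    exact Or.inr (Or.inl rfl)
  refine ⟨R, hR, F ∪ X.draw ((N.C i).induce B), Dv ∪ B, H,
    { isCompact := hFc.union (isCompact_draw (hBC.trans hCle))
      isPreconnected := hE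
      subset_D := union_subset (hFD.trans (hole_subset_D hr hDo.isOpen hDann)) ?_
      disjoint_D := disjoint_D_of_subset_ann (union_subset (hFD.trans hDann) hBD)
      disjoint_draw := fun P hP => ?_
      pos_mem := ?_
      mem_of_hole := fun j hj v hv hvD => Or.inl ⟨⟨j, hj, hv⟩, hvD⟩
      le := hHle
      adj := ?_
      inner_subset := fun v hv => Or.inl hv
      mem_verts := fun v hv => (hHv v hv).imp_right fun hvb => Or.inr ?_
      draw_subset_D := draw_subset_D_of_subset_ann hr hHle hHann ?_
      disjoint_draw_D := disjoint_D_of_subset_ann hHann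
      disjoint_draw_draw := fun P hP hPR => ?_
      isPreconnected_union := ?_ }⟩
  · exact (draw_mono hBC).trans (N.draw_subset_D (one_mem hr) hi' hi.1)
  · obtain ⟨_, _, hP'⟩ := hZ.crossing P hP
    exact ((hZ.disjoint_hole P hP).mono_left hFD).union_left
      (PDE.disjoint_draw (hBC.trans hCle) hP'.le (hBP P hP))
  · rintro v (hv | hv)
    · exact Or.inl (hvF (mem_image_of_mem _ hv))
    · exact Or.inr (pos_mem_draw (H := (N.C i).induce B) hv)
  · rintro u v (huv | huv)
    · exact Or.inl huv.1
    · rcases Sym2.eq_iff.1 huv with ⟨-, rfl⟩ | ⟨-, rfl⟩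
      · exact Or.inr hqR
      · exact Or.inl hqR
  · rw [hvb]
    exact pos_mem_draw (H := (N.C i).induce B) hb₀
  · rw [Set.disjoint_left]
    intro v hv hv1
    rcases hHv v hv with hv | rfl
    · exact hv.1.2 hv1
    · exact (N.cycDisj 1 (one_mem hr) i hi' hi.1.ne).le_bot ⟨hv1, (hBsub hb₀).1⟩
  · obtain ⟨_, _, hP'⟩ := hZ.crossing P hP
    refine PDE.disjoint_draw hHle hP'.le (Set.disjoint_left.2 fun v hv hvP => ?_)
    rcases hHv v hv with hv | rfl
    · exact (hZ.disjoint_inner R hR P hP hPR.symm).le_bot ⟨hv, hvP⟩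
    · exact (hBP P hP).le_bot ⟨hb₀, hvP⟩
  · exact hE.union (X.pos b₀) (Or.inr (pos_mem_draw (H := (N.C i).induce B) hb₀))
      (pos_mem_draw (Or.inr (Or.inl rfl))) (isPreconnected_draw hHle hHconn)

/-- Every intermediate cycle has a segment that avoids the hole, meets all crossing paths other
than `R` and is adjacent to the interior of `R`. -/
theorem IsHub.exists_segment [Finite V] {R : X.G.Subgraph} {E : Set Pt2} {B : Set V}
    {H : X.G.Subgraph} (hub : N.IsHub Z D R E B H) (hR : R ∈ Z) (hne : ∃ P ∈ Z, P ≠ R) {i : ℕ}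
    (hi : i ∈ Ioo 1 r) : ∃ A ⊆ (N.C i).verts, (N.C i).spanningCoe.ConnSet A ∧
      (∀ v ∈ A, X.pos v ∉ D) ∧ Disjoint A (N.inner R) ∧
      (∀ P ∈ Z, P ≠ R → ∃ v ∈ A, v ∈ P.verts) ∧ ∃ u ∈ A, ∃ v ∈ N.inner R, (N.C i).Adj u v := by
  have hi' := mem_Icc_of_mem_Ioo hi
  have hr : 1 ≤ r := hi'.1.trans hi'.2
  have hCle := N.cycLe i hi'
  obtain ⟨p, hp⟩ := (N.diskOpen r (last_mem hr)).nonempty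
  set O := B ∪ N.inner R with hO
  set E' := E ∪ X.draw H with hE'
  have hE'c : IsCompact E' := hub.isCompact.union (isCompact_draw hub.le)
  have hOP : ∀ P ∈ Z, P ≠ R → ∀ v ∈ O, v ∉ P.verts := by
    rintro P hP hPR v (hv | hv) hvP
    · exact (hub.disjoint_draw P hP).le_bot ⟨hub.pos_mem v hv, pos_mem_draw hvP⟩
    · exact (hZ.disjoint_inner R hR P hP hPR.symm).le_bot ⟨hv, hvP⟩
  have hE'D : E' ⊆ N.D 1 := union_subset hub.subset_D hub.draw_subset_D
  have hE'r : Disjoint E' (N.D r) := hub.disjoint_D.union_left hub.disjoint_draw_D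
  have hE'P : ∀ P ∈ Z, P ≠ R → Disjoint E' (X.draw P) := fun P hP hPR =>
    (hub.disjoint_draw P hP).union_left (hub.disjoint_draw_draw P hP hPR)
  have hlog : ∀ P ∈ Z, ∀ K : X.G.Subgraph, ∀ F : Set Pt2, IsCompact F → F ⊆ N.D 1 →
      Disjoint F (N.D r) → Disjoint F (X.draw P) → K ≤ N.C i → Disjoint K.verts P.verts →
      LogAround (F ∪ X.draw K) p := by
    intro P hP K F hFc hFD hFr hFP hK hKP
    obtain ⟨_, _, hP'⟩ := hZ.crossing P hP
    refine hP'.logAround hr (hFc.union (isCompact_draw (hK.trans hCle))) (union_subset hFD ?_)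
      (hFr.union_left ?_) (hFP.union_left (PDE.disjoint_draw (hK.trans hCle) hP'.le hKP)) hp
    · exact (draw_mono hK).trans (N.draw_subset_D (one_mem hr) hi' hi.1)
    · exact disjoint_D_of_subset_ann ((draw_mono hK).trans (draw_cycle_subset_ann hi))
  obtain ⟨P₀, hP₀, hP₀R⟩ := hne
  have hEO := hlog P₀ hP₀ ((N.C i).induce (O ∩ (N.C i).verts)) E' hE'c hE'D hE'r (hE'P P₀ hP₀ hP₀R)
    (induce_le inter_subset_right)
    (Set.disjoint_left.2 fun v hv hvP => hOP P₀ hP₀ hP₀R v hv.1 hvP)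
  have hE'log : LogAround E' p := hEO.mono subset_union_left
  obtain ⟨A, hAC, hA, hAO, hmax, hnot⟩ := PDE.exists_segment hCle (N.isBounded_D hi')
    (N.diskBd i hi').subset (N.nested i r hi'.1 hi'.2 le_rfl hp) (O := O) hE'c.isClosed
    hub.isPreconnected_union (by
      rintro v (hv | hv) -
      · exact Or.inl (hub.pos_mem v hv)
      · exact Or.inr (pos_mem_draw (hub.inner_subset hv))) hE'log hEO
  have hstar : ∀ v ∈ ((N.C i).star A).verts, v ∈ A ∨ v ∈ O := by
    rintro v (hv | ⟨u, hu, huv⟩)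
    · exact Or.inl hv.1
    · exact hmax u hu v huv
  refine ⟨A, hAC, hA, fun v hv hvD => hAO.le_bot ⟨hv, Or.inl (hub.mem_of_hole i hi v (hAC hv) hvD)⟩,
    hAO.mono_right subset_union_right, fun P hP hPR => ?_, ?_⟩
  · by_contra! hAP
    refine hnot (hlog P hP _ E' hE'c hE'D hE'r (hE'P P hP hPR) ((N.C i).star_le A)
      (Set.disjoint_left.2 fun v hv hvP => ?_))
    rcases hstar v hv with hv | hv
    · exact hAP v hv hvP
    · exact hOP P hP hPR v hv hvP
  · by_contra! hAR
    have hR' : ∀ v ∈ ((N.C i).star A).verts, v ∉ N.inner R := by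
      rintro v (hv | ⟨u, hu, huv⟩) hvR
      · exact hAO.le_bot ⟨hv.1, Or.inr hvR⟩
      · exact hAR u hu v hvR huv
    have h1 := hlog R hR ((N.C i).star A) E hub.isCompact hub.subset_D hub.disjoint_D
      (hub.disjoint_draw R hR) ((N.C i).star_le A) (Set.disjoint_left.2 fun v hv hvR =>
        hR' v hv (mem_inner_of_mem_cycle hi (((N.C i).star_le A).1 hv) hvR))
    have hsle := ((N.C i).star_le A).trans hCle
    have hinter : (E ∪ X.draw ((N.C i).star A)) ∩ E' = E := by
      rw [hE', ← union_inter_distrib_left, union_eq_left]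
      refine (draw_inter_draw hsle hub.le fun u v huv huv' => ?_).trans ?_
      · exact (hub.adj u v huv').elim (hR' u (Subgraph.edge_vert _ huv))
          (hR' v (Subgraph.edge_vert _ huv.symm))
      · rintro _ ⟨v, ⟨hv, hvH⟩, rfl⟩
        exact (hub.mem_verts v hvH).resolve_left (hR' v hv)
    refine hnot ((h1.union hE'log (hub.isCompact.union (isCompact_draw hsle)).isClosed
      hE'c.isClosed (by rw [hinter]; exact hub.isPreconnected)).mono ?_)
    exact union_subset subset_union_right (subset_union_right.trans subset_union_left)

end NestedCycles

/-! ### The bramble -/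

/-- A family of disjoint sets that is large compared to `S` has a member missing `S`, as soon as
`S` has two elements outside all members. -/
lemma Finset.exists_disjoint_of_card_le {ι V : Type*} (I : Finset ι) (S : Finset V) (F : ι → Set V)
    (hF : ∀ i ∈ I, ∀ j ∈ I, i ≠ j → Disjoint (F i) (F j)) {x y : V} (hx : x ∈ S) (hy : y ∈ S)
    (hxy : x ≠ y) (hxF : ∀ i ∈ I, x ∉ F i) (hyF : ∀ i ∈ I, y ∉ F i) (hcard : S.card ≤ I.card + 1) :
    ∃ i ∈ I, ∀ v ∈ S, v ∉ F i := by
  classical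
  by_contra! hcon
  have : Nonempty V := ⟨x⟩
  choose! f hfS hfF using hcon
  have h1 : I.card ≤ ((S.erase x).erase y).card := by
    refine Finset.card_le_card_of_injOn f (fun i hi => ?_) fun i hi j hj hij => ?_
    · refine Finset.mem_coe.2 (Finset.mem_erase.2 ⟨fun h => hyF i hi (h ▸ hfF i hi),
        Finset.mem_erase.2 ⟨fun h => hxF i hi (h ▸ hfF i hi), hfS i hi⟩⟩)
    · by_contra hne
      exact (hF i hi j hj hne).le_bot ⟨hfF i hi, hij ▸ hfF j hj⟩
  rw [Finset.card_erase_of_mem (Finset.mem_erase.2 ⟨hxy.symm, hy⟩), Finset.card_erase_of_mem hx]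
    at h1
  have h2 : 1 < S.card := Finset.one_lt_card.2 ⟨x, hx, y, hy, hxy⟩
  omega

namespace NestedCycles

open SimpleGraph PDE

variable {V : Type} {X : PDE V} {r : ℕ} {N : NestedCycles X r} {D : Set Pt2}

lemma mem_verts_cut {i : ℕ} (hi : i ∈ Icc 1 r) {v : V} (hv : v ∈ (N.C i).verts)
    (hvD : X.pos v ∉ D) : v ∈ (X.cut (cyclesUnion N) D).verts := by
  have hle : N.C i ≤ cyclesUnion N := le_iSup₂_of_le i hi le_rfl
  exact ⟨hle.1 hv, fun h => hvD h.2⟩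

lemma adj_cut {i : ℕ} (hi : i ∈ Icc 1 r) {u v : V} (huv : (N.C i).Adj u v)
    (hu : X.pos u ∉ D) (hv : X.pos v ∉ D) : (X.cut (cyclesUnion N) D).Adj u v := by
  have hle : N.C i ≤ cyclesUnion N := le_iSup₂_of_le i hi le_rfl
  exact Subgraph.deleteVerts_adj.2 ⟨hle.1 ((N.C i).edge_vert huv), fun h => hu h.2,
    hle.1 ((N.C i).edge_vert huv.symm), fun h => hv h.2, hle.2 huv⟩

lemma le_cut {i : ℕ} (hi : i ∈ Icc 1 r) (hd : Disjoint D (X.draw (N.C i))) :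
    N.C i ≤ X.cut (cyclesUnion N) D := by
  have h : ∀ v ∈ (N.C i).verts, X.pos v ∉ D := fun v hv hvD => hd.le_bot ⟨hvD, pos_mem_draw hv⟩
  exact ⟨fun v hv => mem_verts_cut hi hv (h v hv), fun u v huv =>
    adj_cut hi huv (h u ((N.C i).edge_vert huv)) (h v ((N.C i).edge_vert huv.symm))⟩

variable [Finite V] {Z : Set X.G.Subgraph}

lemma IsCrossingFamily.exists_isHub (hZ : N.IsCrossingFamily Z D) (hr : 2 < r) (hne : Z.Nonempty)
    (hDo : IsOpenDisk D) (hDann : D ⊆ N.ann) : ∃ R ∈ Z, ∃ E B H, N.IsHub Z D R E B H := by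
  by_cases hD : ∀ i ∈ Ioo 1 r, ∀ v ∈ (N.C i).verts, X.pos v ∉ D
  · obtain ⟨R, hR⟩ := hne
    exact ⟨R, hR, _, _, _, hZ.isHub_of_forall_notMem hr hR hD⟩
  · push Not at hD
    obtain ⟨i, hi, v, hv, hvD⟩ := hD
    exact hZ.exists_isHub_of_mem hne hDo hDann hi hv hvD

theorem IsCrossingFamily.min_le_treewidth (hZ : N.IsCrossingFamily Z D) (hr : 2 < r)
    (hcard : 2 ≤ Z.ncard) (hDo : IsOpenDisk D) (hDann : D ⊆ N.ann) {L : X.G.Subgraph}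
    (hL : ∀ P ∈ Z, P ≤ L) : min r Z.ncard ≤ treewidth (L ⊔ X.cut (cyclesUnion N) D).coe := by
  classical
  set M := L ⊔ X.cut (cyclesUnion N) D with hM
  have hr1 : 1 ≤ r := by omega
  have hZfin : Z.Finite := finite_of_ncard_ne_zero (by omega)
  obtain ⟨R, hR, E, B, H, hub⟩ := hZ.exists_isHub hr (nonempty_of_ncard_ne_zero (by omega)) hDo
    hDann
  have hex : ∃ P ∈ Z, P ≠ R := exists_ne_of_one_lt_ncard (by omega) R
  have hcr : ∀ P ∈ Z, ∃ a b, N.IsCrossing P a b ∧ (N.inner P).Nonempty := by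
    intro P hP
    obtain ⟨a, b, h⟩ := hZ.crossing P hP
    obtain ⟨v, hv, -⟩ := h.exists_mem (i := 2) (by omega) hr
    exact ⟨a, b, h, v, hv⟩
  have hPM : ∀ P ∈ Z, P ≤ M := fun P hP => (hL P hP).trans le_sup_left
  have hCM : X.cut (cyclesUnion N) D ≤ M := le_sup_right
  have hholeP : ∀ P ∈ Z, ∀ v ∈ P.verts, X.pos v ∉ D := fun P hP v hv hvD =>
    (hZ.disjoint_hole P hP).le_bot ⟨hvD, pos_mem_draw hv⟩
  have hC1 : N.C 1 ≤ M := (le_cut (one_mem hr1) (disjoint_hole_first hr1 hDo.isOpen hDann)).trans hCM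
  have hCr : N.C r ≤ M := (le_cut (last_mem hr1) (disjoint_hole_last hr1 hDo.isOpen hDann)).trans hCM
  have hrow : ∀ i ∈ Ico 1 r, ∃ A ⊆ (N.C i).verts, A ⊆ M.verts ∧ M.spanningCoe.ConnSet A ∧
      Disjoint A (N.inner R) ∧ ∀ P ∈ Z, M.spanningCoe.Touch A (N.inner P) := by
    intro i hi
    rcases hi.1.eq_or_lt with rfl | hi1
    · refine ⟨_, subset_rfl, hC1.1, (N.cyc 1 (one_mem hr1)).connSet.mono
        (Subgraph.spanningCoe_mono hC1), Set.disjoint_left.2 fun v hv hvR => hvR.1.2 hv,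
        fun P hP => ?_⟩
      obtain ⟨a, b, h, hne⟩ := hcr P hP
      obtain ⟨v, hv, hav⟩ := h.exists_adj_left hne
      exact ⟨a, h.left_mem.2, v, hv, Or.inr ((hPM P hP).2 hav)⟩
    · have hi' : i ∈ Ioo 1 r := ⟨hi1, hi.2⟩
      have hic := mem_Icc_of_mem_Ioo hi'
      obtain ⟨A, hAC, hA, hAD, hAR, hAP, u, hu, v, hv, huv⟩ := hub.exists_segment hZ hR hex hi'
      refine ⟨A, hAC, fun w hw => hCM.1 (mem_verts_cut hic (hAC hw) (hAD w hw)),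
        ⟨hA.1, fun T h1 h2 => ?_⟩, hAR, fun P hP => ?_⟩
      · obtain ⟨x, hx, y, hy, hxy⟩ := hA.2 T h1 h2
        exact ⟨x, hx, y, hy, hCM.2 (adj_cut hic hxy (hAD x hx.1) (hAD y hy.1))⟩
      · by_cases hPR : P = R
        · subst hPR
          exact ⟨u, hu, v, hv, Or.inr (hCM.2 (adj_cut hic huv (hAD u hu) (hholeP P hP v hv.1.1)))⟩
        · obtain ⟨w, hw, hwP⟩ := hAP P hP hPR
          exact ⟨w, hw, w, mem_inner_of_mem_cycle hi' (hAC hw) hwP, Or.inl rfl⟩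
  choose! A hAC hAM hA hAR hAP using hrow
  have hinner : ∀ P ∈ Z, M.spanningCoe.ConnSet (N.inner P) := fun P hP => by
    obtain ⟨a, b, h, hne⟩ := hcr P hP
    exact (h.connSet_inner hne).mono (Subgraph.spanningCoe_mono (hPM P hP))
  have hlast : ∀ P ∈ Z, M.spanningCoe.Touch (N.inner P) (N.C r).verts := fun P hP => by
    obtain ⟨a, b, h, hne⟩ := hcr P hP
    obtain ⟨v, hv, hbv⟩ := h.exists_adj_right hne
    exact ⟨v, hv, b, h.right_mem.2, Or.inr ((hPM P hP).2 hbv.symm)⟩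
  have hCrc : M.spanningCoe.ConnSet (N.C r).verts :=
    (N.cyc r (last_mem hr1)).connSet.mono (Subgraph.spanningCoe_mono hCr)
  have hcross : ∀ P ∈ Z, ∀ i ∈ Ico 1 r, M.spanningCoe.ConnSet (N.inner P ∪ A i) :=
    fun P hP i hi => (hinner P hP).union (hA i hi) (hAP i hi P hP).symm
  let ℬ : Set (Set V) := {W | W = N.inner R ∨ W = (N.C r).verts ∨
    ∃ P ∈ Z, P ≠ R ∧ ∃ i ∈ Ico 1 r, W = N.inner P ∪ A i}
  refine M.le_treewidth_of_bramble ℬ ?_ ?_ ?_ ?_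
  · rintro _ (rfl | rfl | ⟨P, hP, -, i, hi, rfl⟩)
    · exact (inner_subset R).trans (hPM R hR).1
    · exact hCr.1
    · exact union_subset ((inner_subset P).trans (hPM P hP).1) (hAM i hi)
  · rintro _ (rfl | rfl | ⟨P, hP, -, i, hi, rfl⟩)
    · exact hinner R hR
    · exact hCrc
    · exact hcross P hP i hi
  · have hRX : ∀ P ∈ Z, ∀ i ∈ Ico 1 r, M.spanningCoe.Touch (N.inner R) (N.inner P ∪ A i) :=
      fun P _ i hi => (hAP i hi R hR).symm.mono le_rfl subset_rfl subset_union_right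
    have hrX : ∀ P ∈ Z, ∀ i ∈ Ico 1 r, M.spanningCoe.Touch (N.C r).verts (N.inner P ∪ A i) :=
      fun P hP i _ => (hlast P hP).symm.mono le_rfl subset_rfl subset_union_left
    rintro _ (rfl | rfl | ⟨P, hP, -, i, hi, rfl⟩) _ (rfl | rfl | ⟨P', hP', -, i', hi', rfl⟩)
    · exact (hinner R hR).touch_self
    · exact hlast R hR
    · exact hRX P' hP' i' hi'
    · exact (hlast R hR).symm
    · exact hCrc.touch_self
    · exact hrX P' hP' i' hi'
    · exact (hRX P hP i hi).symm
    · exact (hrX P hP i hi).symm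
    · exact (hAP i' hi' P hP).symm.mono le_rfl subset_union_left subset_union_right
  · intro S hS
    by_cases h1 : ∀ v ∈ S, v ∉ N.inner R
    · exact ⟨_, Or.inl rfl, h1⟩
    by_cases h2 : ∀ v ∈ S, v ∉ (N.C r).verts
    · exact ⟨_, Or.inr (Or.inl rfl), h2⟩
    push Not at h1 h2
    obtain ⟨x, hxS, hx⟩ := h1
    obtain ⟨y, hyS, hy⟩ := h2
    have hxy : x ≠ y := by
      rintro rfl
      exact hx.2 hy
    have hI : (hZfin.toFinset.erase R).card + 1 = Z.ncard := by
      rw [Finset.card_erase_add_one (hZfin.mem_toFinset.2 hR), ncard_eq_toFinset_card Z hZfin]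
    have hmem : ∀ P ∈ hZfin.toFinset.erase R, P ∈ Z ∧ P ≠ R := fun P hP =>
      ⟨hZfin.mem_toFinset.1 (Finset.mem_of_mem_erase hP), Finset.ne_of_mem_erase hP⟩
    obtain ⟨P, hP, hPS⟩ := Finset.exists_disjoint_of_card_le (hZfin.toFinset.erase R) S N.inner
      (fun P hP P' hP' hne => (hZ.disjoint_inner P (hmem P hP).1 P' (hmem P' hP').1 hne).mono_right
        (inner_subset P')) hxS hyS hxy
      (fun P hP h => (hZ.disjoint_inner R hR P (hmem P hP).1 (hmem P hP).2.symm).le_bot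
        ⟨hx, h.1.1⟩) (fun P hP h => h.2 hy) (hI ▸ hS.trans (min_le_right _ _))
    have hIcc : ∀ i ∈ Finset.Ico 1 r, i ∈ Ico 1 r ∧ i ∈ Icc 1 r := fun i hi => by
      rw [Finset.mem_Ico] at hi
      exact ⟨hi, hi.1, hi.2.le⟩
    obtain ⟨i, hi, hiS⟩ := Finset.exists_disjoint_of_card_le (Finset.Ico 1 r) S A
      (fun i hi j hj hij => (N.cycDisj i (hIcc i hi).2 j (hIcc j hj).2 hij).mono
        (hAC i (hIcc i hi).1) (hAC j (hIcc j hj).1)) hxS hyS hxy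
      (fun i hi h => (hAR i (hIcc i hi).1).le_bot ⟨h, hx⟩)
      (fun i hi h => (N.cycDisj i (hIcc i hi).2 r (last_mem hr1) (hIcc i hi).1.2.ne).le_bot
        ⟨hAC i (hIcc i hi).1 h, hy⟩) (by
          rw [Nat.card_Ico]
          have := hS.trans (min_le_left _ _)
          omega)
    exact ⟨_, Or.inr (Or.inr ⟨P, (hmem P hP).1, (hmem P hP).2, i, (hIcc i hi).1, rfl⟩),
      fun v hv h => h.elim (hPS v hv) (hiS v hv)⟩

end NestedCycles

theorem IsStreamCollection.isCrossingFamily {V : Type} [Finite V] {X : PDE V} {r : ℕ}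
    {N : NestedCycles X r} {D : Set Pt2} (hr : 1 ≤ r) {L : X.G.Subgraph} (hL : L.IsLinkage)
    (hfree : X.draw L ∩ D = ∅) {Z : Set X.G.Subgraph} (hZ : IsStreamCollection N L 1 r Z) :
    N.IsCrossingFamily Z D where
  crossing P hP := (hZ.1 P hP).exists_isCrossing hr
  disjoint_inner P hP Q hQ hPQ := by
    obtain ⟨_, _, h⟩ := (hZ.1 P hP).exists_isCrossing hr
    obtain ⟨_, _, h'⟩ := (hZ.1 Q hQ).exists_isCrossing hr
    exact h.disjoint_inner (fun v hv => (hL.1 v hv).2) (hZ.1 P hP).1.1 (hZ.1 Q hQ).1.1 h' hPQ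
  disjoint_hole P hP :=
    ((disjoint_iff_inter_eq_empty.2 hfree).mono_left (PDE.draw_mono (hZ.1 P hP).1.1)).symm

/-- Let `G` be partially `Δ`-embedded, `C` a `Δ`-nested cycle collection,
`D` an open disk with `D ⊆ ann(C)`, `L` an `ann(C)`-avoiding and `D`-free linkage and
`Z` a disjoint collection of `(C,L)`-streams. Then
`tw(L ∪ (⋃C ∖ D)) ≥ min{|C|, |Z|}`. -/
theorem statement13 (V : Type) [Fintype V] (X : PDE V) (r : ℕ)
    (N : NestedCycles X r) (D : Set Pt2) (hDopen : IsOpenDisk D) (hD : D ⊆ N.ann)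
    (L : X.G.Subgraph) (hL : L.IsLinkage)
    (hav : X.drawVerts L.ends ∩ N.ann = ∅) (hfree : X.draw L ∩ D = ∅)
    (Z : Set (X.G.Subgraph)) (hZ : IsStreamCollection N L 1 r Z) :
    min r Z.ncard ≤ treewidth (L ⊔ X.cut (cyclesUnion N) D).coe := by
  rcases Nat.eq_zero_or_pos r with rfl | hr
  · simp
  by_cases h : 2 < r ∧ 2 ≤ Z.ncard
  · exact (hZ.isCrossingFamily hr hL hfree).min_le_treewidth h.1 h.2 hDopen hD
      fun P hP => (hZ.1 P hP).1.1
  · obtain ⟨v, hv⟩ := (N.cyc 1 ⟨le_rfl, hr⟩).1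
    obtain ⟨u, huv⟩ := (N.cyc 1 ⟨le_rfl, hr⟩).exists_adj hv
    have h2 := (N.cyc 1 ⟨le_rfl, hr⟩).two_le_treewidth huv ((NestedCycles.le_cut ⟨le_rfl, hr⟩
      (NestedCycles.disjoint_hole_first hr hDopen.isOpen hD)).trans (le_sup_right (a := L)))
    omega
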